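/- arXiv:1702.03403 — 2 statements merged into one kernel-verified Lean document; each statement's English description precedes it below -/
import Mathlib

section
/- Every sequence of 157 elements of (ℤ/5ℤ)^4 contains a subsequence of length exactly 5 whose sum is zero; that is, 𝔰((ℤ/5ℤ)^4) ≤ 157. -/
open Finset

/-- The multiplicity function `m` describes a sequence over `V` in which no five terms sum to
zero: every zero-sum 5-tuple uses some value more often than it is available. -/
def NoZeroSumFive {V : Type*} [AddCommMonoid V] [DecidableEq V] (m : V → ℕ) : Prop :=
  ∀ v : Fin 5 → V, ∑ j, v j = 0 → ∃ u, m u < #{j | v j = u}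

theorem sum_powerset_neg_one_pow_mul_prod_affine {ι κ R : Type*} [DecidableEq ι] [DecidableEq κ]
    [CommRing R] (c : κ → R) (a : κ → ι → R) (J : Finset ι) :
    ∀ K : Finset κ, #K < #J →
      ∑ I ∈ J.powerset, (-1) ^ #I * ∏ k ∈ K, (c k + ∑ i ∈ I, a k i) = 0 := by
  induction J using Finset.induction_on with
  | empty => intro K hK; simp at hK
  | insert i J hi ih =>
    intro K hK
    rw [card_insert_of_notMem hi] at hK
    rw [sum_powerset_insert hi, ← sum_add_distrib]
    have key : ∀ I ∈ J.powerset,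
        ((-1) ^ #I * ∏ k ∈ K, (c k + ∑ i ∈ I, a k i) +
          (-1) ^ #(insert i I) * ∏ k ∈ K, (c k + ∑ i ∈ insert i I, a k i)) =
        - ∑ t ∈ K.powerset.erase K, (∏ k ∈ K \ t, a k i) *
          ((-1) ^ #I * ∏ k ∈ t, (c k + ∑ i ∈ I, a k i)) := by
      intro I hI
      have hiI : i ∉ I := fun h => hi (mem_powerset.1 hI h)
      have h1 : ∏ k ∈ K, (c k + ∑ i ∈ insert i I, a k i) =
          ∏ k ∈ K, ((c k + ∑ i ∈ I, a k i) + a k i) := by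
        refine prod_congr rfl fun k _ => ?_
        rw [sum_insert hiI]; ring
      rw [h1, prod_add (fun k => c k + ∑ i ∈ I, a k i) (fun k => a k i),
        ← add_sum_erase _ _ (mem_powerset_self K), card_insert_of_notMem hiI, sdiff_self,
        bot_eq_empty, prod_empty, mul_one, mul_add, ← sum_neg_distrib, mul_sum, ← add_assoc,
        pow_succ, mul_neg_one, neg_mul, add_neg_cancel, zero_add]
      refine sum_congr rfl fun t _ => ?_
      ring
    rw [sum_congr rfl key, sum_neg_distrib, sum_comm, neg_eq_zero]
    refine sum_eq_zero fun t ht => ?_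
    rw [← mul_sum, ih t, mul_zero]
    have : #t < #K := card_lt_card
      ((mem_powerset.1 (mem_of_mem_erase ht)).ssubset_of_ne (ne_of_mem_erase ht))
    omega

theorem prod_nonzero_neg_add_zmod_five :
    ∀ l : ZMod 5, ∏ c ∈ univ.filter (fun c : ZMod 5 => c ≠ 0), (-c + l) =
      -(if l = 0 then 1 else 0) := by
  decide

theorem sum_zero_sum_subsets_containing {ι : Type*} [DecidableEq ι] {d : ℕ}
    (x : ι → Fin d → ZMod 5) (A J : Finset ι) (h : 4 * (d + 1) + #A < #J) :
    ∑ I ∈ J.powerset, (-1) ^ #I * (if ∑ i ∈ I, x i = 0 ∧ 5 ∣ #I then 1 else 0) *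
      (if A ⊆ I then 1 else 0) = (0 : ZMod 5) := by
  let K : Finset ((Option (Fin d) × ZMod 5) ⊕ ι) :=
    (univ ×ˢ univ.filter (fun c : ZMod 5 => c ≠ 0)).disjSum A
  let c : (Option (Fin d) × ZMod 5) ⊕ ι → ZMod 5 := Sum.elim (fun p => -p.2) (fun _ => 0)
  let a : (Option (Fin d) × ZMod 5) ⊕ ι → ι → ZMod 5 :=
    Sum.elim (fun p i => p.1.elim 1 (x i)) (fun j i => if i = j then 1 else 0)
  have hK : #K < #J := by
    have h4 : #(univ.filter (fun c : ZMod 5 => c ≠ 0)) = 4 := by decide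
    simp only [K, card_disjSum, card_product, h4, card_univ, Fintype.card_option, Fintype.card_fin]
    omega
  have key := sum_powerset_neg_one_pow_mul_prod_affine c a J K hK
  have hprod : ∀ I : Finset ι, ∏ k ∈ K, (c k + ∑ i ∈ I, a k i) =
      (-1) ^ (d + 1) * ((if ∑ i ∈ I, x i = 0 ∧ 5 ∣ #I then 1 else 0) *
        (if A ⊆ I then 1 else 0)) := by
    intro I
    simp only [K, prod_disjSum, prod_product, c, a, Sum.elim_inl, Sum.elim_inr,
      prod_nonzero_neg_add_zmod_five]
    have hA : ∏ j ∈ A, (0 + ∑ i ∈ I, if i = j then (1 : ZMod 5) else 0) =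
        if A ⊆ I then 1 else 0 := by
      simp only [zero_add, sum_ite_eq', prod_ite_zero, prod_const_one]
      rfl
    have hx : (∀ r ∈ (univ : Finset (Option (Fin d))), ∑ i ∈ I, r.elim 1 (x i) = 0) ↔
        (∑ i ∈ I, x i = 0 ∧ 5 ∣ #I) := by
      simp only [mem_univ, true_imp_iff, Option.forall, Option.elim, sum_const, nsmul_eq_mul,
        mul_one, ZMod.natCast_eq_zero_iff, funext_iff, Finset.sum_apply, Pi.zero_apply]
      exact and_comm
    rw [prod_neg, prod_ite_zero, prod_const_one, hA, card_univ, Fintype.card_option,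
      Fintype.card_fin, mul_assoc]
    simp only [hx]
  simp only [hprod] at key
  have h2 : ((-1 : ZMod 5) ^ (d + 1)) * ∑ I ∈ J.powerset, (-1) ^ #I *
      (if ∑ i ∈ I, x i = 0 ∧ 5 ∣ #I then 1 else 0) * (if A ⊆ I then 1 else 0) = 0 := by
    refine Eq.trans ?_ key
    rw [mul_sum]
    exact sum_congr rfl fun I _ => by ring
  have : Fact (Nat.Prime 5) := ⟨by norm_num⟩
  exact (mul_eq_zero.1 h2).resolve_left (pow_ne_zero _ (neg_ne_zero.2 one_ne_zero))

theorem NoZeroSumFive.sum_ne_zero {V : Type*} [AddCommMonoid V] [DecidableEq V] {m : V → ℕ}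
    (hm : NoZeroSumFive m) (I : Finset (Σ v, Fin (m v))) (hI : #I = 5) :
    ∑ i ∈ I, i.1 ≠ 0 := by
  intro h0
  let e : Fin 5 ≃ I := (Fintype.equivFinOfCardEq (by simpa using hI)).symm
  have hs : ∑ j, (e j).1.1 = 0 := by
    rw [← h0, ← sum_coe_sort I (fun i => i.1)]
    exact Equiv.sum_comp e (fun i : I => i.1.1)
  obtain ⟨u, hu⟩ := hm (fun j => (e j).1.1) hs
  refine absurd hu (not_lt.2 ?_)
  have : #{j | (e j).1.1 = u} ≤ #(univ : Finset (Fin (m u))) := by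
    rw [← card_map (Function.Embedding.sigmaMk (β := fun v => Fin (m v)) u)]
    refine card_le_card_of_injOn (fun j => (e j).1) ?_
      (fun j _ k _ h => e.injective (Subtype.ext h))
    intro j hj
    simp only [coe_filter, mem_univ, true_and, Set.mem_ofPred_eq] at hj
    subst hj
    simp
  simpa using this

theorem NoZeroSumFive.sum_le_seventeen {m : (Fin 2 → ZMod 5) → ℕ} (hm : NoZeroSumFive m) :
    ∑ v, m v ≤ 17 := by
  by_contra! hlt
  have hcard : 18 ≤ #(univ : Finset (Σ v, Fin (m v))) := by simpa using Nat.succ_le_of_lt hlt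
  obtain ⟨X, -, hX⟩ := exists_subset_card_eq hcard
  have h5 := hm.sum_ne_zero
  have h15 : ∀ J : Finset (Σ v, Fin (m v)), #J = 15 → ∑ i ∈ J, i.1 ≠ 0 := by
    intro J hJ hJ0
    obtain ⟨i, hi⟩ : J.Nonempty := card_pos.1 (by omega)
    have hJi : #(J.erase i) = 14 := by rw [card_erase_of_mem hi, hJ]
    have key := sum_zero_sum_subsets_containing (fun i : (Σ v, Fin (m v)) => i.1) ∅ (J.erase i)
      (by simp [hJi])
    rw [sum_eq_single ∅] at key
    · simp at key
      revert key; decide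
    · intro I hI hne
      rw [mem_powerset] at hI
      have hle := card_le_card hI
      rw [if_neg, mul_zero, zero_mul]
      rintro ⟨hI0, k, hk⟩
      have hpos : 0 < #I := card_pos.2 (nonempty_iff_ne_empty.2 hne)
      obtain rfl | rfl : k = 1 ∨ k = 2 := by omega
      · exact h5 I hk hI0
      · have hIJ : I ⊆ J := hI.trans (erase_subset _ _)
        refine h5 (J \ I) (by rw [card_sdiff_of_subset hIJ, hJ, hk]) ?_
        have := sum_sdiff (f := fun i : (Σ v, Fin (m v)) => i.1) hIJ
        rwa [hI0, hJ0, add_zero] at this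
    · simp
  let g : Finset (Σ v, Fin (m v)) → ZMod 5 := fun I =>
    (-1) ^ #I * (if ∑ i ∈ I, i.1 = 0 ∧ 5 ∣ #I then 1 else 0)
  have hsum : ∑ I ∈ X.powerset, g I = 0 := by
    have := sum_zero_sum_subsets_containing (fun i : (Σ v, Fin (m v)) => i.1) ∅ X (by simp [hX])
    simpa [g] using this
  have hsum5 : ∑ I ∈ X.powerset, g I * ((#I).choose 5 : ℕ) = 0 := by
    have h1 : ∀ A ∈ X.powersetCard 5, ∑ I ∈ X.powerset, g I * (if A ⊆ I then 1 else 0) = 0 := by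
      intro A hA
      exact sum_zero_sum_subsets_containing (fun i : (Σ v, Fin (m v)) => i.1) A X
        (by rw [(mem_powersetCard.1 hA).2, hX]; norm_num)
    rw [← sum_eq_zero h1, sum_comm]
    refine sum_congr rfl fun I hI => ?_
    rw [← mul_sum, sum_boole]
    congr 2
    rw [← card_powersetCard]
    congr 1
    ext A
    simp only [mem_powersetCard, mem_filter]
    exact ⟨fun h => ⟨⟨h.1.trans (mem_powerset.1 hI), h.2⟩, h.1⟩, fun h => ⟨h.2, h.1.2⟩⟩
  have hfin : ∑ I ∈ X.powerset, g I * (((#I).choose 5 : ℕ) - 2 : ZMod 5) = -2 := by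
    rw [sum_eq_single ∅]
    · simp [g]
    · intro I hI hne
      have hle := card_le_card (mem_powerset.1 hI)
      have hpos : 0 < #I := card_pos.2 (nonempty_iff_ne_empty.2 hne)
      by_cases hg : ∑ i ∈ I, i.1 = 0 ∧ 5 ∣ #I
      · obtain ⟨hI0, k, hk⟩ := hg
        obtain rfl | rfl | rfl : k = 1 ∨ k = 2 ∨ k = 3 := by omega
        · exact absurd hI0 (h5 I hk)
        · rw [hk]
          have : (((5 * 2).choose 5 : ℕ) - 2 : ZMod 5) = 0 := by decide
          rw [this, mul_zero]
        · exact absurd hI0 (h15 I hk)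
      · simp only [g, if_neg hg, mul_zero, zero_mul]
    · simp
  simp only [mul_sub, sum_sub_distrib, hsum5, ← sum_mul, hsum] at hfin
  revert hfin
  decide

section Character

open ZMod

theorem stdAddChar_five_natCast (k : ℕ) :
    (stdAddChar (k : ZMod 5)).re = Real.cos (2 * Real.pi * k / 5) ∧
    (stdAddChar (k : ZMod 5)).im = Real.sin (2 * Real.pi * k / 5) := by
  have h := stdAddChar_coe (N := 5) (k : ℤ)
  have h2 : (2 * Real.pi * Complex.I * ((k : ℤ) : ℂ) / (5 : ℕ) : ℂ) =
      ((2 * Real.pi * k / 5 : ℝ) : ℂ) * Complex.I := by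
    push_cast; ring
  rw [h2] at h
  rw [Int.cast_natCast] at h
  rw [h, Complex.exp_ofReal_mul_I_re, Complex.exp_ofReal_mul_I_im]
  exact ⟨rfl, rfl⟩

theorem cos_two_pi_div_five : Real.cos (2 * Real.pi / 5) = (√5 - 1) / 4 := by
  have h5 : √5 ^ 2 = 5 := Real.sq_sqrt (by norm_num)
  rw [mul_div_assoc, Real.cos_two_mul, Real.cos_pi_div_five]
  linear_combination h5 / 8

theorem cos_two_pi_div_five_bounds :
    0.3 ≤ Real.cos (2 * Real.pi / 5) ∧ Real.cos (2 * Real.pi / 5) ≤ 0.3091 := by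
  rw [cos_two_pi_div_five]
  have h1 : 2.2 ≤ √5 := Real.le_sqrt_of_sq_le (by norm_num)
  have h2 : √5 ≤ 2.2364 := Real.sqrt_le_iff.2 (by norm_num)
  constructor <;> linarith

theorem stdAddChar_five_re_le {t : ZMod 5} (ht : t ≠ 0) : (stdAddChar t).re ≤ 0.3091 := by
  obtain ⟨hlo, hhi⟩ := cos_two_pi_div_five_bounds
  have h2 : Real.cos (2 * Real.pi * (2 : ℕ) / 5) ≤ 0.3091 := by
    have : 2 * Real.pi * (2 : ℕ) / 5 = 2 * (2 * Real.pi / 5) := by push_cast; ring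
    rw [this, Real.cos_two_mul]
    nlinarith
  have hcase : ∀ t : ZMod 5, t ≠ 0 →
      t = (1 : ℕ) ∨ t = (2 : ℕ) ∨ t = (3 : ℕ) ∨ t = (4 : ℕ) := by decide
  rcases hcase t ht with rfl | rfl | rfl | rfl <;> rw [(stdAddChar_five_natCast _).1]
  · simpa using hhi
  · exact h2
  · have : 2 * Real.pi * (3 : ℕ) / 5 = 2 * Real.pi - 2 * Real.pi * (2 : ℕ) / 5 := by
      push_cast; ring
    rwa [this, Real.cos_two_pi_sub]
  · have : 2 * Real.pi * (4 : ℕ) / 5 = 2 * Real.pi - 2 * Real.pi / 5 := by push_cast; ring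
    rwa [this, Real.cos_two_pi_sub]

theorem five_term_character_sum_bounds (d : ZMod 5 → ℝ) {M R : ℝ} (h0 : ∀ j, 0 ≤ d j)
    (hM : ∀ j, d j ≤ M) (hR : M + 0.3091 * (∑ j, d j - M) ≤ R) :
    ((∑ j, (d j : ℂ) * stdAddChar j) ^ 5).re ≤
        R ^ 3 * Complex.normSq (∑ j, (d j : ℂ) * stdAddChar j) ∧
      Complex.normSq (∑ j, (d j : ℂ) * stdAddChar j) ≤ (5 / 4 * R) ^ 2 ∧ 0 ≤ R := by
  set z : ℂ := ∑ j, (d j : ℂ) * stdAddChar j with hz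
  obtain ⟨k, hk⟩ := Finite.exists_max (fun k : ZMod 5 => (stdAddChar k * z).re)
  have hpow : (stdAddChar k * z) ^ 5 = z ^ 5 := by
    rw [mul_pow, ← AddChar.map_nsmul_eq_pow]
    have : (5 : ℕ) • k = 0 := (by decide : ∀ k : ZMod 5, 5 • k = 0) k
    rw [this, AddChar.map_zero_eq_one, one_mul]
  have hnorm : Complex.normSq (stdAddChar k * z) = Complex.normSq z := by
    rw [Complex.normSq_mul, Complex.normSq_eq_norm_sq, AddChar.norm_apply, one_pow, one_mul]
  have hxR : (stdAddChar k * z).re ≤ R := by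
    refine le_trans ?_ hR
    have h1 : (stdAddChar k * z).re = ∑ j, d j * (stdAddChar (k + j)).re := by
      rw [hz, mul_sum, Complex.re_sum]
      refine sum_congr rfl fun j _ => ?_
      rw [AddChar.map_add_eq_mul, mul_left_comm, Complex.re_ofReal_mul]
    have h2 : ∑ j, d j * (stdAddChar (k + j)).re ≤
        ∑ j, (0.3091 * d j + if -k = j then (1 - 0.3091) * d j else 0) := by
      refine sum_le_sum fun j _ => ?_
      split_ifs with h
      · rw [← h, add_neg_cancel, AddChar.map_zero_eq_one, Complex.one_re]
        exact le_of_eq (by ring)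
      · rw [add_zero, mul_comm]
        refine mul_le_mul_of_nonneg_right (stdAddChar_five_re_le fun h' => h ?_) (h0 j)
        exact neg_eq_of_add_eq_zero_right h'
    rw [h1]
    refine h2.trans ?_
    rw [sum_add_distrib, ← mul_sum, sum_ite_eq, if_pos (mem_univ _)]
    linarith [hM (-k)]
  have hp := hk (k + 1)
  have hn := hk (k - 1)
  rw [← hpow, ← hnorm]
  rw [add_comm, AddChar.map_add_eq_mul, mul_assoc] at hp
  rw [sub_eq_neg_add, AddChar.map_add_eq_mul, mul_assoc, AddChar.map_neg_eq_conj] at hn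
  generalize stdAddChar k * z = w at *
  obtain ⟨hc, hs⟩ := stdAddChar_five_natCast 1
  obtain ⟨hlo, hhi⟩ := cos_two_pi_div_five_bounds
  have hsc := Real.sin_sq_add_cos_sq (2 * Real.pi / 5)
  simp only [Nat.cast_one, mul_one] at hc hs
  rw [Complex.mul_re] at hp hn
  rw [Complex.conj_re, Complex.conj_im] at hn
  rw [hc, hs] at hp hn
  have hre5 : (w ^ 5).re = w.re ^ 5 - 10 * w.re ^ 3 * w.im ^ 2 + 5 * w.re * w.im ^ 4 := by
    simp only [pow_succ, pow_zero, one_mul, Complex.mul_re, Complex.mul_im]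
    ring
  rw [Complex.normSq_apply, hre5]
  generalize Real.cos (2 * Real.pi / 5) = c at *
  generalize Real.sin (2 * Real.pi / 5) = s at *
  generalize w.re = x at *
  generalize w.im = y at *
  have hx : 0 ≤ x := by nlinarith
  have hR0 : 0 ≤ R := hx.trans hxR
  have hsq : s ^ 2 * y ^ 2 ≤ (1 - c) ^ 2 * x ^ 2 := by
    rw [← mul_pow, ← mul_pow]
    exact sq_le_sq' (by linarith) (by linarith)
  have hy : y ^ 2 ≤ 0.54 * x ^ 2 := by
    have h1 : (1 + c) * y ^ 2 ≤ (1 - c) * x ^ 2 := by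
      have hs2 : s ^ 2 = (1 - c) * (1 + c) := by linarith
      rw [hs2] at hsq
      refine le_of_mul_le_mul_left (a := 1 - c) ?_ (by linarith)
      linarith
    nlinarith [sq_nonneg x, sq_nonneg y]
  have hx3 : x ^ 3 ≤ R ^ 3 := pow_le_pow_left₀ hx hxR 3
  have hx2 : x ^ 2 ≤ R ^ 2 := pow_le_pow_left₀ hx hxR 2
  refine ⟨?_, by nlinarith, hR0⟩
  have h1 : x ^ 5 - 10 * x ^ 3 * y ^ 2 + 5 * x * y ^ 4 ≤ x ^ 3 * (x * x + y * y) := by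
    have : 0 ≤ x * y ^ 2 * (11 * x ^ 2 - 5 * y ^ 2) :=
      mul_nonneg (mul_nonneg hx (sq_nonneg y)) (by nlinarith [sq_nonneg x])
    linarith
  exact h1.trans (mul_le_mul_of_nonneg_right hx3 (by nlinarith [sq_nonneg x, sq_nonneg y]))

end Character

section Fourier

open ZMod

variable {d : ℕ}

/-- The Fourier transform of a multiplicity function on `(ℤ/5ℤ)^d`. -/
noncomputable def fourierSum (m : (Fin d → ZMod 5) → ℕ) (ξ : Fin d → ZMod 5) : ℂ :=
  ∑ v, (m v : ℂ) * stdAddChar (ξ ⬝ᵥ v)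

/-- The number of `k`-tuples with sum `u`, each weighted by the multiplicities of its entries. -/
def tupleCount (m : (Fin d → ZMod 5) → ℕ) (k : ℕ) (u : Fin d → ZMod 5) : ℕ :=
  ∑ v : Fin k → Fin d → ZMod 5, if ∑ j, v j = u then ∏ j, m (v j) else 0

theorem AddChar.map_finset_sum {A M ι : Type*} [AddCommMonoid A] [CommMonoid M] (ψ : AddChar A M)
    (s : Finset ι) (f : ι → A) : ψ (∑ i ∈ s, f i) = ∏ i ∈ s, ψ (f i) := by
  classical
  induction s using Finset.induction_on with
  | empty => simp
  | insert i s hi ih => rw [sum_insert hi, prod_insert hi, AddChar.map_add_eq_mul, ih]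

theorem sum_stdAddChar_dotProduct (u : Fin d → ZMod 5) :
    ∑ ξ : Fin d → ZMod 5, (stdAddChar (ξ ⬝ᵥ u) : ℂ) = if u = 0 then 5 ^ d else 0 := by
  split_ifs with hu
  · simp [hu]
  · let f : (Fin d → ZMod 5) →+ ZMod 5 :=
      { toFun := fun ξ => ξ ⬝ᵥ u
        map_zero' := zero_dotProduct u
        map_add' := fun a b => add_dotProduct a b u }
    refine AddChar.sum_eq_zero_of_ne_one (ψ := (stdAddChar (N := 5)).compAddMonoidHom f) ?_
    intro h
    obtain ⟨i, hi⟩ := Function.ne_iff.1 hu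
    have h1 := DFunLike.congr_fun h (Pi.single i 1)
    have h2 : stdAddChar (u i) = stdAddChar (0 : ZMod 5) := by
      simpa [f] using h1
    exact hi (injective_stdAddChar h2)

theorem sum_fourierSum_pow (m : (Fin d → ZMod 5) → ℕ) (k : ℕ) (u : Fin d → ZMod 5) :
    ∑ ξ, fourierSum m ξ ^ k * stdAddChar (ξ ⬝ᵥ -u) = (5 ^ d * tupleCount m k u : ℂ) := by
  have h : ∀ ξ, fourierSum m ξ ^ k * stdAddChar (ξ ⬝ᵥ -u) =
      ∑ v : Fin k → Fin d → ZMod 5, (∏ j, (m (v j) : ℂ)) *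
        stdAddChar (ξ ⬝ᵥ (∑ j, v j - u)) := by
    intro ξ
    rw [fourierSum, Fintype.sum_pow, sum_mul]
    refine sum_congr rfl fun v _ => ?_
    rw [prod_mul_distrib, sub_eq_add_neg, dotProduct_add, AddChar.map_add_eq_mul,
      dotProduct_sum, AddChar.map_finset_sum, mul_assoc]
  simp only [h]
  rw [sum_comm, tupleCount]
  push_cast
  rw [mul_sum]
  refine sum_congr rfl fun v _ => ?_
  simp only [← mul_sum, sum_stdAddChar_dotProduct, sub_eq_zero]
  split_ifs <;> ring

theorem sum_normSq_fourierSum (m : (Fin d → ZMod 5) → ℕ) :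
    ∑ ξ, Complex.normSq (fourierSum m ξ) = (5 ^ d * ∑ v, (m v : ℝ) ^ 2) := by
  have h : ∀ ξ, (Complex.normSq (fourierSum m ξ) : ℂ) =
      ∑ v, ∑ w, (m v * m w : ℂ) * stdAddChar (ξ ⬝ᵥ (v - w)) := by
    intro ξ
    rw [← Complex.mul_conj, fourierSum, map_sum, sum_mul_sum]
    refine sum_congr rfl fun v _ => sum_congr rfl fun w _ => ?_
    rw [map_mul, Complex.conj_natCast, ← AddChar.map_neg_eq_conj, sub_eq_add_neg, dotProduct_add,
      AddChar.map_add_eq_mul, dotProduct_neg]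
    ring
  apply Complex.ofReal_injective
  push_cast
  simp only [h]
  rw [sum_comm, mul_sum]
  refine sum_congr rfl fun v _ => ?_
  rw [sum_comm]
  simp only [← mul_sum, sum_stdAddChar_dotProduct, sub_eq_zero]
  simp only [mul_ite, mul_zero, sum_ite_eq, mem_univ, if_true]
  ring

theorem fourierSum_zero (m : (Fin d → ZMod 5) → ℕ) : fourierSum m 0 = ∑ v, (m v : ℂ) := by
  simp [fourierSum]

theorem fourierSum_bounds (m : (Fin d → ZMod 5) → ℕ) {M : ℕ} {R : ℝ} {ξ : Fin d → ZMod 5}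
    (hM : ∀ j, ∑ v with ξ ⬝ᵥ v = j, m v ≤ M)
    (hR : M + 0.3091 * (4 * M - ∑ v, (m v : ℝ)) ≤ R) :
    -(R ^ 3 * Complex.normSq (fourierSum m ξ)) ≤ (fourierSum m ξ ^ 5).re ∧
      ‖fourierSum m ξ‖ ≤ 5 / 4 * R := by
  let c : ZMod 5 → ℝ := fun j => ∑ v with ξ ⬝ᵥ v = j, (m v : ℝ)
  have hc0 : ∀ j, 0 ≤ c j := fun j => sum_nonneg fun v _ => Nat.cast_nonneg _
  have hcM : ∀ j, c j ≤ M := fun j => by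
    have := hM j
    simp only [c]
    exact_mod_cast this
  have hcsum : ∑ j, c j = ∑ v, (m v : ℝ) := sum_fiberwise _ _ _
  have hF : fourierSum m ξ = ∑ j, (c j : ℂ) * stdAddChar j := by
    rw [fourierSum, ← sum_fiberwise univ (fun v => ξ ⬝ᵥ v)]
    refine sum_congr rfl fun j _ => ?_
    simp only [c]
    push_cast
    rw [sum_mul]
    refine sum_congr rfl fun v hv => ?_
    rw [(mem_filter.1 hv).2]
  have hz : ∑ j : ZMod 5, (stdAddChar j : ℂ) = 0 := by
    refine AddChar.sum_eq_zero_of_ne_one fun h => ?_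
    have h1 : stdAddChar (1 : ZMod 5) = stdAddChar (0 : ZMod 5) := by
      rw [h, AddChar.one_apply, AddChar.one_apply]
    exact absurd (injective_stdAddChar h1) (by decide)
  have hneg : ∑ j, ((M - c j : ℝ) : ℂ) * stdAddChar j = -fourierSum m ξ := by
    rw [hF]
    push_cast
    simp only [sub_mul, sum_sub_distrib, ← mul_sum, hz]
    ring
  obtain ⟨h1, h2, h3⟩ := five_term_character_sum_bounds (fun j => M - c j) (M := M) (R := R)
    (fun j => sub_nonneg.2 (hcM j)) (fun j => sub_le_self _ (hc0 j)) (by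
      rw [sum_sub_distrib, hcsum, sum_const, card_univ, ZMod.card, nsmul_eq_mul]
      push_cast
      linarith)
  rw [hneg, Complex.normSq_neg] at h1 h2
  constructor
  · have : (-fourierSum m ξ) ^ 5 = -(fourierSum m ξ ^ 5) := by ring
    rw [this, Complex.neg_re] at h1
    linarith
  · rw [Complex.normSq_eq_norm_sq] at h2
    exact le_of_sq_le_sq h2 (by positivity)

end Fourier

section Degenerate

variable {d : ℕ} {m : (Fin d → ZMod 5) → ℕ}

theorem five_nsmul_eq_zero (u : Fin d → ZMod 5) : 5 • u = 0 := by
  ext i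
  exact (by decide : ∀ a : ZMod 5, 5 • a = 0) (u i)

theorem NoZeroSumFive.le_four (hm : NoZeroSumFive m) (u : Fin d → ZMod 5) : m u ≤ 4 := by
  obtain ⟨w, hw⟩ := hm (fun _ => u) (by simpa using five_nsmul_eq_zero u)
  by_cases h : u = w
  · subst h
    simp at hw
    omega
  · simp [h] at hw

theorem sum_fin_succ_arrow {V N : Type*} [Fintype V] [AddCommMonoid N] {k : ℕ}
    (G : (Fin (k + 1) → V) → N) : ∑ v, G v = ∑ a, ∑ w : Fin k → V, G (Fin.cons a w) := by
  rw [← (Fin.consEquiv fun _ : Fin (k + 1) => V).sum_comp, Fintype.sum_prod_type]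
  rfl

theorem tupleCount_two_le (h4 : ∀ u, m u ≤ 4) (u : Fin d → ZMod 5) :
    tupleCount m 2 u ≤ 4 * ∑ v, m v := by
  rw [tupleCount, sum_fin_succ_arrow, mul_sum]
  refine sum_le_sum fun a _ => ?_
  rw [sum_fin_succ_arrow, sum_eq_single (u - a)]
  · rw [Fintype.sum_unique]
    split_ifs
    · simpa [Fin.prod_univ_succ, mul_comm] using Nat.mul_le_mul_left (m a) (h4 (u - a))
    · exact Nat.zero_le _
  · intro b _ hb
    refine sum_eq_zero fun w _ => if_neg fun h => hb ?_
    rw [← h]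
    simp [Fin.sum_univ_succ]
  · simp

/-- The weight of a 5-tuple: the product of its multiplicities if it sums to zero. -/
def zeroSumWeight (m : (Fin d → ZMod 5) → ℕ) (v : Fin 5 → Fin d → ZMod 5) : ℕ :=
  if ∑ j, v j = 0 then ∏ j, m (v j) else 0

theorem zeroSumWeight_comp_perm (σ : Equiv.Perm (Fin 5)) (v : Fin 5 → Fin d → ZMod 5) :
    zeroSumWeight m (v ∘ σ) = zeroSumWeight m v := by
  simp only [zeroSumWeight, Function.comp_apply]
  rw [Equiv.sum_comp σ v, Equiv.prod_comp σ (fun j => m (v j))]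

theorem sum_zeroSumWeight_constant_on_congr {s t : Finset (Fin 5)} (hst : #s = #t)
    (u : Fin d → ZMod 5) :
    ∑ v, (if ∀ j ∈ s, v j = u then zeroSumWeight m v else 0) =
      ∑ v, (if ∀ j ∈ t, v j = u then zeroSumWeight m v else 0) := by
  obtain ⟨σ, hσ⟩ := Equiv.Perm.exists_map_finset_eq s t hst
  rw [← (Equiv.arrowCongr σ.symm (Equiv.refl (Fin d → ZMod 5))).sum_comp]
  refine sum_congr rfl fun v _ => ?_
  have h1 : (Equiv.arrowCongr σ.symm (Equiv.refl (Fin d → ZMod 5))) v = v ∘ σ := rfl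
  rw [h1, zeroSumWeight_comp_perm]
  refine if_congr ?_ rfl rfl
  rw [← hσ, forall_mem_map]
  rfl

theorem sum_zeroSumWeight_pair (u : Fin d → ZMod 5) :
    ∑ v, (if ∀ j ∈ ({0, 1} : Finset (Fin 5)), v j = u then zeroSumWeight m v else 0) =
      m u ^ 2 * tupleCount m 3 (-(2 • u)) := by
  rw [sum_fin_succ_arrow, sum_eq_single u, sum_fin_succ_arrow, sum_eq_single u, tupleCount,
    mul_sum]
  · refine sum_congr rfl fun w _ => ?_
    rw [if_pos (by simp only [mem_insert, mem_singleton]; rintro j (rfl | rfl) <;> rfl),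
      zeroSumWeight, mul_ite, mul_zero]
    refine if_congr ?_ ?_ rfl
    · rw [Fin.sum_cons, Fin.sum_cons, ← add_assoc, two_nsmul, add_comm, eq_neg_iff_add_eq_zero]
    · simp only [Fin.prod_univ_succ (n := 4), Fin.prod_univ_succ (n := 3), Fin.cons_zero,
        Fin.cons_succ]
      ring
  · exact fun b _ hb => sum_eq_zero fun w _ => if_neg fun h => hb (h 1 (by simp))
  · simp
  · exact fun b _ hb => sum_eq_zero fun w _ => if_neg fun h => hb (h 0 (by simp))
  · simp

theorem sum_zeroSumWeight_triple (u : Fin d → ZMod 5) :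
    ∑ v, (if ∀ j ∈ ({0, 1, 2} : Finset (Fin 5)), v j = u then zeroSumWeight m v else 0) =
      m u ^ 3 * tupleCount m 2 (-(3 • u)) := by
  rw [sum_fin_succ_arrow, sum_eq_single u, sum_fin_succ_arrow, sum_eq_single u,
    sum_fin_succ_arrow, sum_eq_single u, tupleCount, mul_sum]
  · refine sum_congr rfl fun w _ => ?_
    rw [if_pos (by simp only [mem_insert, mem_singleton]; rintro j (rfl | rfl | rfl) <;> rfl),
      zeroSumWeight, mul_ite, mul_zero]
    refine if_congr ?_ ?_ rfl
    · rw [Fin.sum_cons, Fin.sum_cons, Fin.sum_cons, ← add_assoc, ← add_assoc, succ_nsmul,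
        two_nsmul, add_comm, eq_neg_iff_add_eq_zero]
    · simp only [Fin.prod_univ_succ (n := 4), Fin.prod_univ_succ (n := 3),
        Fin.prod_univ_succ (n := 2), Fin.cons_zero, Fin.cons_succ]
      ring
  · exact fun b _ hb => sum_eq_zero fun w _ => if_neg fun h => hb (h 2 (by simp))
  · simp
  · exact fun b _ hb => sum_eq_zero fun w _ => if_neg fun h => hb (h 1 (by simp))
  · simp
  · exact fun b _ hb => sum_eq_zero fun w _ => if_neg fun h => hb (h 0 (by simp))
  · simp

theorem NoZeroSumFive.zeroSumWeight_le (hm : NoZeroSumFive m) (v : Fin 5 → Fin d → ZMod 5) :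
    zeroSumWeight m v ≤
      ∑ s ∈ powersetCard 2 univ, ∑ u with m u = 1,
        (if ∀ j ∈ s, v j = u then zeroSumWeight m v else 0) +
      ∑ s ∈ powersetCard 3 univ, ∑ u with m u = 2,
        (if ∀ j ∈ s, v j = u then zeroSumWeight m v else 0) +
      ∑ u, (if v = fun _ => u then m u ^ 5 else 0) := by
  by_cases hv : zeroSumWeight m v = 0
  · rw [hv]; exact Nat.zero_le _
  have hv0 : ∑ j, v j = 0 := by
    by_contra h
    exact hv (if_neg h)
  have hpos : ∀ j, m (v j) ≠ 0 := by
    intro j hj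
    refine hv ?_
    rw [zeroSumWeight, if_pos hv0]
    exact prod_eq_zero (mem_univ j) hj
  obtain ⟨u, hu⟩ := hm v hv0
  have key : ∀ c, m u = c → zeroSumWeight m v ≤ ∑ s ∈ powersetCard (c + 1) univ,
      ∑ u with m u = c, (if ∀ j ∈ s, v j = u then zeroSumWeight m v else 0) := by
    intro c hc
    obtain ⟨s, hs, hsc⟩ := exists_subset_card_eq (Nat.succ_le_of_lt (hc ▸ hu))
    have h1 : ∀ j ∈ s, v j = u := fun j hj => (mem_filter.1 (hs hj)).2
    refine le_trans ?_ (single_le_sum (fun _ _ => Nat.zero_le _)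
      (mem_powersetCard.2 ⟨subset_univ s, hsc⟩))
    refine le_trans ?_ (single_le_sum (fun _ _ => Nat.zero_le _)
      (mem_filter.2 ⟨mem_univ u, hc⟩))
    rw [if_pos h1]
  obtain h0 | h1 | h2 | h3 : m u = 0 ∨ m u = 1 ∨ m u = 2 ∨ 3 ≤ m u := by omega
  · rw [h0, card_pos] at hu
    obtain ⟨j, hj⟩ := hu
    exact absurd ((mem_filter.1 hj).2 ▸ h0) (hpos j)
  · exact (key 1 h1).trans ((Nat.le_add_right _ _).trans (Nat.le_add_right _ _))
  · exact (key 2 h2).trans ((Nat.le_add_left _ _).trans (Nat.le_add_right _ _))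
  · have hall : v = fun _ => u := by
      funext i
      by_contra hi
      have hsub : ({j | v j = u} : Finset (Fin 5)) ⊆ univ.erase i := by
        intro j hj
        refine mem_erase.2 ⟨?_, mem_univ j⟩
        rintro rfl
        exact hi (mem_filter.1 hj).2
      have heq := eq_of_subset_of_card_le hsub (by simp; omega)
      have hsum := add_sum_erase univ v (mem_univ i)
      rw [← heq, sum_congr rfl fun j hj => (mem_filter.1 hj).2, heq, hv0, sum_const] at hsum
      have h5 := five_nsmul_eq_zero u
      rw [card_erase_of_mem (mem_univ i), card_univ, Fintype.card_fin] at hsum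
      refine hi ?_
      rw [succ_nsmul'] at h5
      exact add_right_cancel (hsum.trans h5.symm)
    refine le_trans ?_ (Nat.le_add_left _ _)
    refine le_trans ?_ (single_le_sum (fun _ _ => Nat.zero_le _) (mem_univ u))
    rw [if_pos hall, zeroSumWeight, if_pos hv0, hall]
    simp

theorem NoZeroSumFive.tupleCount_five_le (hm : NoZeroSumFive m) {T : ℕ}
    (hT : ∀ u, tupleCount m 3 u ≤ T) :
    tupleCount m 5 0 ≤ 10 * (#{u | m u = 1} * T) + 10 * (#{u | m u = 2} * (32 * ∑ v, m v)) +
      ∑ u, m u ^ 5 := by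
  have h := sum_le_sum fun v (_ : v ∈ univ) => hm.zeroSumWeight_le v
  refine h.trans ?_
  rw [sum_add_distrib, sum_add_distrib]
  refine add_le_add (add_le_add ?_ ?_) ?_
  · rw [sum_comm]
    have hs : ∀ s ∈ powersetCard 2 (univ : Finset (Fin 5)), ∑ v, ∑ u with m u = 1,
        (if ∀ j ∈ s, v j = u then zeroSumWeight m v else 0) ≤ #{u | m u = 1} * T := by
      intro s hs
      rw [sum_comm]
      refine sum_le_card_nsmul _ _ _ fun u hu => ?_
      rw [sum_zeroSumWeight_constant_on_congr (t := {0, 1}) (mem_powersetCard.1 hs).2,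
        sum_zeroSumWeight_pair, (mem_filter.1 hu).2, one_pow, one_mul]
      exact hT _
    exact sum_le_card_nsmul _ _ _ hs
  · rw [sum_comm]
    have hs : ∀ s ∈ powersetCard 3 (univ : Finset (Fin 5)), ∑ v, ∑ u with m u = 2,
        (if ∀ j ∈ s, v j = u then zeroSumWeight m v else 0) ≤
          #{u | m u = 2} * (32 * ∑ v, m v) := by
      intro s hs
      rw [sum_comm]
      refine sum_le_card_nsmul _ _ _ fun u hu => ?_
      rw [sum_zeroSumWeight_constant_on_congr (t := {0, 1, 2}) (mem_powersetCard.1 hs).2,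
        sum_zeroSumWeight_triple, (mem_filter.1 hu).2]
      have := tupleCount_two_le hm.le_four (-(3 • u))
      omega
    exact sum_le_card_nsmul _ _ _ hs
  · rw [sum_comm]
    simp

end Degenerate

section Bounds

variable {d : ℕ} {m : (Fin d → ZMod 5) → ℕ}

theorem NoZeroSumFive.mono (hm : NoZeroSumFive m) {m' : (Fin d → ZMod 5) → ℕ} (h : m' ≤ m) :
    NoZeroSumFive m' := fun v hv =>
  let ⟨u, hu⟩ := hm v hv
  ⟨u, (h u).trans_lt hu⟩

theorem exists_le_sum_eq {V : Type*} [Fintype V] [DecidableEq V] (m : V → ℕ) (n : ℕ)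
    (hn : n ≤ ∑ v, m v) : ∃ m' ≤ m, ∑ v, m' v = n := by
  induction n with
  | zero => exact ⟨0, fun v => Nat.zero_le _, by simp⟩
  | succ n ih =>
    obtain ⟨m', hle, hsum⟩ := ih (by omega)
    obtain ⟨v, -, hv⟩ := exists_lt_of_sum_lt (show ∑ v, m' v < ∑ v, m v by omega)
    refine ⟨m' + Pi.single v 1, fun w => ?_, ?_⟩
    · by_cases h : w = v
      · subst h
        simpa using hv
      · simpa [h] using hle w
    · simp [sum_add_distrib, hsum]

theorem NoZeroSumFive.sum_hyperplane_le {M : ℕ}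
    (hB : ∀ m' : (Fin d → ZMod 5) → ℕ, NoZeroSumFive m' → ∑ v, m' v ≤ M)
    {m : (Fin (d + 1) → ZMod 5) → ℕ} (hm : NoZeroSumFive m) {ξ : Fin (d + 1) → ZMod 5}
    (hξ : ξ ≠ 0) (j : ZMod 5) : ∑ v with ξ ⬝ᵥ v = j, m v ≤ M := by
  have : Fact (Nat.Prime 5) := ⟨by norm_num⟩
  obtain ⟨i, hi⟩ := Function.ne_iff.1 hξ
  rw [Pi.zero_apply] at hi
  let φ : (Fin d → ZMod 5) → Fin (d + 1) → ZMod 5 := fun w =>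
    i.insertNth ((ξ i)⁻¹ * (j - ∑ k, ξ (i.succAbove k) * w k)) w
  have hφi : ∀ w, φ w i = (ξ i)⁻¹ * (j - ∑ k, ξ (i.succAbove k) * w k) := fun w =>
    Fin.insertNth_apply_same _ _ _
  have hφs : ∀ w k, φ w (i.succAbove k) = w k := fun w k => Fin.insertNth_apply_succAbove _ _ _ _
  have hinj : Function.Injective φ := fun w w' h => funext fun k => by rw [← hφs w, h, hφs]
  have hm' : NoZeroSumFive (m ∘ φ) := by
    intro w hw
    have hsum : ∑ t, φ (w t) = 0 := by
      have hw' : ∀ k, ∑ t, w t k = 0 := fun k => by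
        rw [← Finset.sum_apply, hw, Pi.zero_apply]
      funext k
      rw [Finset.sum_apply, Pi.zero_apply]
      rcases Fin.eq_self_or_eq_succAbove i k with rfl | ⟨k, rfl⟩
      · simp only [hφi]
        rw [← mul_sum, sum_sub_distrib, sum_comm]
        simp only [← mul_sum, hw']
        simp [show (5 : ZMod 5) = 0 from rfl]
      · simpa only [hφs] using hw' k
    obtain ⟨u, hu⟩ := hm (fun t => φ (w t)) hsum
    obtain ⟨t, ht⟩ := card_pos.1 ((Nat.zero_le _).trans_lt hu)
    refine ⟨w t, ?_⟩
    rw [← (mem_filter.1 ht).2] at hu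
    simpa only [Function.comp_apply, hinj.eq_iff] using hu
  refine le_trans ?_ (hB _ hm')
  have himage : univ.filter (fun v => ξ ⬝ᵥ v = j) ⊆ univ.image φ := by
    intro v hv
    refine mem_image.2 ⟨i.removeNth v, mem_univ _, ?_⟩
    have hv' := (mem_filter.1 hv).2
    rw [dotProduct, Fin.sum_univ_succAbove _ i] at hv'
    funext k
    rcases Fin.eq_self_or_eq_succAbove i k with rfl | ⟨k, rfl⟩
    · rw [hφi, ← hv']
      simp only [Fin.removeNth]
      field_simp
      ring
    · rw [hφs, Fin.removeNth]
  refine (sum_le_sum_of_subset himage).trans_eq ?_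
  rw [sum_image hinj.injOn]
  rfl

theorem NoZeroSumFive.pow_five_le (hm : NoZeroSumFive m) {M : ℕ} {R : ℝ}
    (hM : ∀ ξ : Fin d → ZMod 5, ξ ≠ 0 → ∀ j, ∑ v with ξ ⬝ᵥ v = j, m v ≤ M)
    (hR : M + 0.3091 * (4 * M - ∑ v, (m v : ℝ)) ≤ R) {n E : ℝ} (hn : n = ∑ v, (m v : ℝ))
    (hE : E = 5 ^ d * ∑ v, (m v : ℝ) ^ 2 - n ^ 2) :
    n ^ 5 ≤ R ^ 3 * E + 10 * #{u | m u = 1} * (n ^ 3 + 5 / 4 * R * E) +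
      5 ^ d * (320 * #{u | m u = 2} * n + ∑ u, (m u : ℝ) ^ 5) := by
  have hE' : E = ∑ ξ ∈ univ.erase 0, Complex.normSq (fourierSum m ξ) := by
    have h := add_sum_erase univ (fun ξ => Complex.normSq (fourierSum m ξ))
      (mem_univ (0 : Fin d → ZMod 5))
    have h0 : Complex.normSq (fourierSum m 0) = n ^ 2 := by
      rw [fourierSum_zero, hn]
      have : ∑ v, (m v : ℂ) = ((∑ v, (m v : ℝ) : ℝ) : ℂ) := by push_cast; rfl
      rw [this, Complex.normSq_ofReal, sq]
    rw [sum_normSq_fourierSum, h0] at h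
    linarith
  have hzero : fourierSum m 0 = (n : ℂ) := by
    rw [fourierSum_zero, hn]; push_cast; rfl
  have hb : ∀ ξ ∈ univ.erase (0 : Fin d → ZMod 5),
      -(R ^ 3 * Complex.normSq (fourierSum m ξ)) ≤ (fourierSum m ξ ^ 5).re ∧
        ‖fourierSum m ξ‖ ≤ 5 / 4 * R := fun ξ hξ =>
    fourierSum_bounds m (hM ξ (ne_of_mem_erase hξ)) hR
  have h5 : n ^ 5 - R ^ 3 * E ≤ 5 ^ d * tupleCount m 5 0 := by
    have h := congrArg Complex.re (sum_fourierSum_pow m 5 0)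
    rw [← add_sum_erase univ _ (mem_univ (0 : Fin d → ZMod 5))] at h
    simp only [hzero, neg_zero, dotProduct_zero, AddChar.map_zero_eq_one, mul_one,
      Complex.add_re, Complex.re_sum] at h
    have hr : ((5 : ℂ) ^ d * (tupleCount m 5 0 : ℂ)).re = 5 ^ d * tupleCount m 5 0 := by
      rw [show ((5 : ℂ) ^ d * (tupleCount m 5 0 : ℂ)) =
        ((5 ^ d * tupleCount m 5 0 : ℝ) : ℂ) by push_cast; rfl, Complex.ofReal_re]
    have hn5 : ((n : ℂ) ^ 5).re = n ^ 5 := by rw [← Complex.ofReal_pow, Complex.ofReal_re]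
    rw [hr, hn5] at h
    have hsum := sum_le_sum fun ξ hξ => (hb ξ hξ).1
    rw [sum_neg_distrib, ← mul_sum, ← hE'] at hsum
    linarith
  have h3 : ∀ u, 5 ^ d * (tupleCount m 3 u : ℝ) ≤ n ^ 3 + 5 / 4 * R * E := by
    intro u
    have h := congrArg norm (sum_fourierSum_pow m 3 u)
    rw [norm_mul, norm_pow, Complex.norm_natCast, Complex.norm_ofNat] at h
    rw [← h, ← add_sum_erase univ _ (mem_univ (0 : Fin d → ZMod 5))]
    refine (norm_add_le _ _).trans (add_le_add ?_ ((norm_sum_le _ _).trans ?_))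
    · have hn0 : 0 ≤ n := by rw [hn]; positivity
      rw [hzero, norm_mul, AddChar.norm_apply, mul_one, norm_pow, Complex.norm_real,
        Real.norm_of_nonneg hn0]
    · rw [hE', mul_sum]
      refine sum_le_sum fun ξ hξ => ?_
      rw [norm_mul, AddChar.norm_apply, mul_one, norm_pow, Complex.normSq_eq_norm_sq, pow_succ']
      exact mul_le_mul_of_nonneg_right (hb ξ hξ).2 (sq_nonneg _)
  obtain ⟨u₀, hu₀⟩ := Finite.exists_max (tupleCount m 3)
  have hcount : (tupleCount m 5 0 : ℝ) ≤ 10 * (#{u | m u = 1} * tupleCount m 3 u₀) +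
      10 * (#{u | m u = 2} * (32 * n)) + ∑ u, (m u : ℝ) ^ 5 := by
    rw [hn]
    exact_mod_cast hm.tupleCount_five_le hu₀
  have hq : (0 : ℝ) < 5 ^ d := by positivity
  have h6 := mul_le_mul_of_nonneg_left hcount hq.le
  have h7 := mul_le_mul_of_nonneg_left (h3 u₀) (by positivity : (0 : ℝ) ≤ 10 * #{u | m u = 1})
  linarith

theorem NoZeroSumFive.sum_sq_le (hm : NoZeroSumFive m) :
    ∑ v, (m v : ℝ) ^ 2 + 3 * #{u | m u = 1} + 4 * #{u | m u = 2} ≤ 4 * ∑ v, (m v : ℝ) := by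
  have h : ∑ v, m v ^ 2 + 3 * #{u | m u = 1} + 4 * #{u | m u = 2} ≤ 4 * ∑ v, m v := by
    rw [card_filter, card_filter, mul_sum, mul_sum, mul_sum, ← sum_add_distrib,
      ← sum_add_distrib]
    refine sum_le_sum fun v _ => ?_
    have h4 := hm.le_four v
    generalize m v = a at *
    revert a
    decide
  exact_mod_cast h

theorem NoZeroSumFive.sum_pow_five_le (hm : NoZeroSumFive m) :
    ∑ v, (m v : ℝ) ^ 5 ≤ 256 * ∑ v, (m v : ℝ) := by
  rw [mul_sum]
  refine sum_le_sum fun v _ => ?_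
  have h4 : (m v : ℝ) ≤ 4 := by exact_mod_cast hm.le_four v
  have := pow_le_pow_left₀ (Nat.cast_nonneg _) h4 4
  nlinarith [Nat.cast_nonneg (α := ℝ) (m v)]

theorem NoZeroSumFive.exists_counts (hm : NoZeroSumFive m) {M : ℕ} {R n : ℝ}
    (hM : ∀ ξ : Fin d → ZMod 5, ξ ≠ 0 → ∀ j, ∑ v with ξ ⬝ᵥ v = j, m v ≤ M)
    (hR : M + 0.3091 * (4 * M - n) ≤ R) (hR0 : 0 ≤ R) (hn : n = ∑ v, (m v : ℝ)) :
    ∃ a b : ℝ, 0 ≤ a ∧ 0 ≤ b ∧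
      n ^ 5 ≤ (R ^ 3 + 12.5 * R * a) * (5 ^ d * (4 * n - 3 * a - 4 * b) - n ^ 2) +
        10 * a * n ^ 3 + 5 ^ d * (320 * b * n + 256 * n) := by
  refine ⟨#{u | m u = 1}, #{u | m u = 2}, Nat.cast_nonneg _, Nat.cast_nonneg _, ?_⟩
  have h := hm.pow_five_le hM (hn ▸ hR) hn rfl
  have h2 := hm.sum_sq_le
  have h5 := hm.sum_pow_five_le
  rw [← hn] at h2 h5
  have hq : (0 : ℝ) ≤ 5 ^ d := by positivity
  have ha : (0 : ℝ) ≤ #{u | m u = 1} := Nat.cast_nonneg _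
  have hE : 5 ^ d * ∑ v, (m v : ℝ) ^ 2 - n ^ 2 ≤
      5 ^ d * (4 * n - 3 * #{u | m u = 1} - 4 * #{u | m u = 2}) - n ^ 2 :=
    sub_le_sub_right (mul_le_mul_of_nonneg_left (by linarith) hq) _
  have h6 := mul_le_mul_of_nonneg_left hE
    (by positivity : (0 : ℝ) ≤ R ^ 3 + 12.5 * R * #{u | m u = 1})
  have h7 := mul_le_mul_of_nonneg_left h5 hq
  linarith

theorem NoZeroSumFive.sum_le_forty_nine {m : (Fin 3 → ZMod 5) → ℕ} (hm : NoZeroSumFive m) :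
    ∑ v, m v ≤ 49 := by
  by_contra! hlt
  obtain ⟨m', hle, hsum⟩ := exists_le_sum_eq m 50 (by omega)
  have hm' := hm.mono hle
  have hn : (50 : ℝ) = ∑ v, (m' v : ℝ) := by exact_mod_cast hsum.symm
  obtain ⟨a, b, ha, hb, h⟩ := hm'.exists_counts (M := 17) (R := 22.57)
    (fun ξ hξ => hm'.sum_hyperplane_le (fun _ h => h.sum_le_seventeen) hξ)
    (by norm_num) (by norm_num) hn
  norm_num at h
  clear hn hsum hlt
  nlinarith [mul_nonneg ha hb, sq_nonneg (a - 15)]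

theorem NoZeroSumFive.sum_ne_one_hundred_fifty_seven {m : (Fin 4 → ZMod 5) → ℕ}
    (hm : NoZeroSumFive m) : ∑ v, m v ≠ 157 := by
  intro hsum
  have hn : (157 : ℝ) = ∑ v, (m v : ℝ) := by exact_mod_cast hsum.symm
  obtain ⟨a, b, ha, hb, h⟩ := hm.exists_counts (M := 49) (R := 61.06)
    (fun ξ hξ => hm.sum_hyperplane_le (fun _ h => h.sum_le_forty_nine) hξ)
    (by norm_num) (by norm_num) hn
  norm_num at h
  clear hn hsum
  nlinarith [mul_nonneg ha hb, sq_nonneg a]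

end Bounds

theorem s_const_zmod5_pow4_le :
    ∀ S : Multiset (Fin 4 → ZMod 5), S.card = 157 →
      ∃ T : Multiset (Fin 4 → ZMod 5), T ≤ S ∧ T.card = 5 ∧ T.sum = 0 := by
  intro S hS
  by_contra! hT
  have hm : NoZeroSumFive (fun v => S.count v) := by
    intro v hv
    by_contra! hle
    refine hT (univ.val.map v) (Multiset.le_iff_count.2 fun u => ?_) (by simp) hv
    rw [Multiset.count_map]
    refine le_trans (le_of_eq ?_) (hle u)
    rw [card_def, filter_val]
    simp only [eq_comm]
  refine hm.sum_ne_one_hundred_fifty_seven ?_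
  rw [← hS]
  exact Multiset.sum_count_eq_card fun _ _ => mem_univ _
end

section
/- Every sequence of 690 elements of (ℤ/5ℤ)^5 contains a subsequence of length exactly 5 whose sum is zero; that is, 𝔰((ℤ/5ℤ)^5) ≤ 690. -/
open Finset

section PrimeFive

local instance fact_prime_five : Fact (Nat.Prime 5) := ⟨Nat.prime_five⟩

section Fourier

variable {V : Type} [AddCommGroup V] [Module (ZMod 5) V]

/-- The Fourier coefficient at `φ` of the indicator function of `A`. -/
noncomputable def indicatorCoeff (A : Finset V) (φ : Module.Dual (ZMod 5) V) : ℂ :=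
  ∑ x ∈ A, ZMod.stdAddChar (φ x)

/-- The number of points of `A` on the affine hyperplane `φ = j`. -/
def fiberCard (A : Finset V) (φ : Module.Dual (ZMod 5) V) (j : ZMod 5) : ℕ :=
  #{x ∈ A | φ x = j}

/-- The number of solutions in `A` of the linear equation with coefficients `c`. -/
noncomputable def solutionCount [DecidableEq V] {k : ℕ} (A : Finset V) (c : Fin k → ZMod 5) : ℕ :=
  #{x ∈ Fintype.piFinset fun _ => A | ∑ i, c i • x i = 0}

@[simp]
theorem indicatorCoeff_zero (A : Finset V) : indicatorCoeff A 0 = #A := by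
  simp [indicatorCoeff]

theorem indicatorCoeff_eq_sum_fiberCard (A : Finset V) (φ : Module.Dual (ZMod 5) V) :
    indicatorCoeff A φ = ∑ j, (fiberCard A φ j : ℂ) * ZMod.stdAddChar j := by
  unfold indicatorCoeff fiberCard
  rw [← Finset.sum_fiberwise' A φ fun j => (ZMod.stdAddChar j : ℂ)]
  simp

theorem sum_fiberCard (A : Finset V) (φ : Module.Dual (ZMod 5) V) :
    ∑ j, fiberCard A φ j = #A :=
  (Finset.card_eq_sum_card_fiberwise fun _ _ => Finset.mem_univ _).symm

theorem indicatorCoeff_neg_smul (A : Finset V) (k : ZMod 5) (φ : Module.Dual (ZMod 5) V) :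
    indicatorCoeff A (-k • φ) = (starRingEnd ℂ) (indicatorCoeff A (k • φ)) := by
  simp [indicatorCoeff, AddChar.map_neg_eq_conj]

theorem stdAddChar_sum {ι : Type*} (s : Finset ι) (f : ι → ZMod 5) :
    (ZMod.stdAddChar (∑ i ∈ s, f i) : ℂ) = ∏ i ∈ s, ZMod.stdAddChar (f i) := by
  classical
  induction s using Finset.induction_on with
  | empty => simp
  | insert i s hi ih => rw [sum_insert hi, prod_insert hi, AddChar.map_add_eq_mul, ih]

theorem prod_indicatorCoeff_smul [DecidableEq V] {k : ℕ} (A : Finset V) (c : Fin k → ZMod 5)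
    (φ : Module.Dual (ZMod 5) V) :
    ∏ i, indicatorCoeff A (c i • φ) =
      ∑ x ∈ Fintype.piFinset fun _ => A, ZMod.stdAddChar (φ (∑ i, c i • x i)) := by
  unfold indicatorCoeff
  rw [Finset.prod_univ_sum]
  refine Finset.sum_congr rfl fun x _ => ?_
  rw [map_sum, stdAddChar_sum]
  simp

instance finite_dual [Finite V] : Finite (Module.Dual (ZMod 5) V) :=
  Module.finite_of_finite (ZMod 5)

variable [Finite V] [Fintype (Module.Dual (ZMod 5) V)]

theorem sum_stdAddChar_dual (y : V) [Decidable (y = 0)] :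
    ∑ φ : Module.Dual (ZMod 5) V, (ZMod.stdAddChar (φ y) : ℂ) =
      if y = 0 then (5 : ℂ) ^ Module.finrank (ZMod 5) V else 0 := by
  split_ifs with h
  · subst h
    simp only [map_zero, AddChar.map_zero_eq_one, sum_const, card_univ]
    rw [Module.card_eq_pow_finrank (K := ZMod 5), Subspace.dual_finrank_eq]
    simp
  · obtain ⟨φ, hφ⟩ : ∃ φ : Module.Dual (ZMod 5) V, φ y ≠ 0 := by
      by_contra! hc
      exact h ((Module.forall_dual_apply_eq_zero_iff (ZMod 5) y).1 hc)
    let ψ : AddChar (Module.Dual (ZMod 5) V) ℂ :=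
      (ZMod.stdAddChar (N := 5)).compAddMonoidHom (Module.Dual.eval (ZMod 5) V y).toAddMonoidHom
    refine AddChar.sum_eq_zero_of_ne_one (ψ := ψ) fun hψ => hφ ?_
    apply ZMod.injective_stdAddChar (N := 5)
    rw [AddChar.map_zero_eq_one]
    exact DFunLike.congr_fun hψ φ

theorem sum_prod_indicatorCoeff [DecidableEq V] {k : ℕ} (A : Finset V) (c : Fin k → ZMod 5) :
    ∑ φ : Module.Dual (ZMod 5) V, ∏ i, indicatorCoeff A (c i • φ) =
      (5 : ℂ) ^ Module.finrank (ZMod 5) V * solutionCount A c := by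
  simp_rw [prod_indicatorCoeff_smul]
  rw [Finset.sum_comm]
  simp_rw [sum_stdAddChar_dual]
  rw [← Finset.sum_filter, Finset.sum_const, nsmul_eq_mul, mul_comm, solutionCount]

theorem sum_indicatorCoeff_pow_five [DecidableEq V] (A : Finset V) :
    ∑ φ : Module.Dual (ZMod 5) V, indicatorCoeff A φ ^ 5 =
      (5 : ℂ) ^ Module.finrank (ZMod 5) V * solutionCount A (1 : Fin 5 → ZMod 5) := by
  rw [← sum_prod_indicatorCoeff]
  simp

theorem sum_indicatorCoeff_two_smul_mul_pow [DecidableEq V] (A : Finset V) (k : Fin 4) :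
    ∑ φ : Module.Dual (ZMod 5) V, indicatorCoeff A ((2 : ZMod 5) • φ) * indicatorCoeff A φ ^ 3 =
      (5 : ℂ) ^ Module.finrank (ZMod 5) V *
        solutionCount A (Function.update (1 : Fin 4 → ZMod 5) k 2) := by
  rw [← sum_prod_indicatorCoeff]
  refine Finset.sum_congr rfl fun φ _ => ?_
  rw [← Finset.mul_prod_erase _ _ (Finset.mem_univ k), Function.update_self]
  congr 1
  rw [Finset.prod_congr rfl (g := fun _ => indicatorCoeff A φ)]
  · simp
  · intro i hi
    simp [Function.update_of_ne (Finset.ne_of_mem_erase hi)]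

theorem sum_norm_indicatorCoeff_sq (A : Finset V) :
    ∑ φ : Module.Dual (ZMod 5) V, ‖indicatorCoeff A φ‖ ^ 2 =
      (5 : ℝ) ^ Module.finrank (ZMod 5) V * #A := by
  classical
  have h := sum_prod_indicatorCoeff A ![(1 : ZMod 5), -1]
  have hc : solutionCount A ![(1 : ZMod 5), -1] = #A := by
    unfold solutionCount
    refine (Finset.card_bij (fun a _ => fun _ => a) ?_ ?_ ?_).symm
    · intro a ha
      simp [ha]
    · intro a _ b _ hab
      exact congrFun hab 0
    · intro x hx
      simp only [mem_filter, Fintype.mem_piFinset, Fin.sum_univ_two] at hx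
      refine ⟨x 0, hx.1 0, ?_⟩
      have h2 := hx.2
      simp only [Matrix.cons_val_zero, Matrix.cons_val_one, one_smul, neg_smul,
        add_neg_eq_zero] at h2
      funext i
      fin_cases i
      · rfl
      · exact h2
  rw [hc] at h
  simp only [Fin.prod_univ_two, Matrix.cons_val_zero, Matrix.cons_val_one,
    indicatorCoeff_neg_smul, one_smul, Complex.mul_conj, Complex.normSq_eq_norm_sq] at h
  exact_mod_cast h

end Fourier

section Fibers

variable {V : Type} [AddCommGroup V] [Module (ZMod 5) V]

theorem sum_norm_indicatorCoeff_smul_sq (A : Finset V) (φ : Module.Dual (ZMod 5) V) :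
    ∑ k : ZMod 5, ‖indicatorCoeff A (k • φ)‖ ^ 2 = 5 * ∑ j, (fiberCard A φ j : ℝ) ^ 2 := by
  have hz : ∀ k, indicatorCoeff A (k • φ) =
      ∑ j, (fiberCard A φ j : ℂ) * ZMod.stdAddChar (k * j) := by
    intro k
    unfold indicatorCoeff fiberCard
    simp only [LinearMap.smul_apply, smul_eq_mul]
    rw [← Finset.sum_fiberwise' A φ fun j => (ZMod.stdAddChar (k * j) : ℂ)]
    simp
  have hs : ∀ k, ((‖indicatorCoeff A (k • φ)‖ ^ 2 : ℝ) : ℂ) =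
      ∑ i, ∑ j, (fiberCard A φ i : ℂ) * fiberCard A φ j * ZMod.stdAddChar (k * (i - j)) := by
    intro k
    rw [← Complex.normSq_eq_norm_sq, ← Complex.mul_conj, hz, map_sum, Finset.sum_mul_sum]
    refine Finset.sum_congr rfl fun i _ => Finset.sum_congr rfl fun j _ => ?_
    rw [mul_sub, sub_eq_add_neg, AddChar.map_add_eq_mul, AddChar.map_neg_eq_conj]
    simp
    ring
  have : ((∑ k : ZMod 5, ‖indicatorCoeff A (k • φ)‖ ^ 2 : ℝ) : ℂ) =
      ((5 * ∑ j, (fiberCard A φ j : ℝ) ^ 2 : ℝ) : ℂ) := by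
    rw [Complex.ofReal_sum]
    simp_rw [hs]
    rw [Finset.sum_comm]
    push_cast
    rw [Finset.mul_sum]
    refine Finset.sum_congr rfl fun i _ => ?_
    rw [Finset.sum_comm]
    simp_rw [← Finset.mul_sum, AddChar.sum_mulShift _ (ZMod.isPrimitive_stdAddChar 5), sub_eq_zero]
    simp
    ring
  exact_mod_cast this

theorem norm_indicatorCoeff_sq_add (A : Finset V) (φ : Module.Dual (ZMod 5) V) :
    2 * (‖indicatorCoeff A φ‖ ^ 2 + ‖indicatorCoeff A ((2 : ZMod 5) • φ)‖ ^ 2) =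
      5 * ∑ j, (fiberCard A φ j : ℝ) ^ 2 - (#A : ℝ) ^ 2 := by
  rw [← sum_norm_indicatorCoeff_smul_sq]
  have h3 : indicatorCoeff A ((3 : ZMod 5) • φ) =
      (starRingEnd ℂ) (indicatorCoeff A ((2 : ZMod 5) • φ)) :=
    indicatorCoeff_neg_smul A 2 φ
  have h4 : indicatorCoeff A ((4 : ZMod 5) • φ) =
      (starRingEnd ℂ) (indicatorCoeff A ((1 : ZMod 5) • φ)) :=
    indicatorCoeff_neg_smul A 1 φ
  have hu : ∀ g : ZMod 5 → ℝ, ∑ k, g k = g 0 + g 1 + g 2 + g 3 + g 4 := fun g =>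
    Fin.sum_univ_five g
  rw [hu, h3, h4]
  simp
  ring

/-- The minimum of `∑ aᵢ (F - aᵢ)` over `0 ≤ aᵢ ≤ F` with prescribed sum. -/
theorem mod_mul_sub_mod_le_sum {ι : Type*} (s : Finset ι) {F : ℕ} (hF : 0 < F) (a : ι → ℕ)
    (ha : ∀ i ∈ s, a i ≤ F) :
    (∑ i ∈ s, a i) % F * (F - (∑ i ∈ s, a i) % F) ≤ ∑ i ∈ s, a i * (F - a i) := by
  refine (Finset.le_sum_of_subadditive (fun m : ℕ => m % F * (F - m % F)) (by simp) ?_ s a).trans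
    (Finset.sum_le_sum fun i hi => ?_)
  · intro x y
    have hx := Nat.mod_lt x hF
    have hy := Nat.mod_lt y hF
    simp only [Nat.add_mod x y F]
    generalize x % F = u at *
    generalize y % F = v at *
    rcases lt_or_ge (u + v) F with h | h
    · rw [Nat.mod_eq_of_lt h]
      zify [h.le, hx.le, hy.le]
      nlinarith
    · obtain ⟨w, hw⟩ := Nat.exists_eq_add_of_le h
      rw [hw, Nat.add_mod_left, Nat.mod_eq_of_lt (by omega)]
      have hwF : w ≤ F := by omega
      zify [hwF, hx.le, hy.le] at hw hx hy ⊢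
      have hw' : (w : ℤ) = u + v - F := by linarith
      rw [hw']
      nlinarith [mul_nonneg (sub_nonneg.2 hx.le) (sub_nonneg.2 hy.le)]
  · rcases (ha i hi).lt_or_eq with h | h
    · simp [Nat.mod_eq_of_lt h]
    · simp [h]

theorem sum_fiberCard_sq_le (A : Finset V) (φ : Module.Dual (ZMod 5) V) {F : ℕ} (hF : 0 < F)
    (h : ∀ j, fiberCard A φ j ≤ F) :
    ∑ j, (fiberCard A φ j : ℝ) ^ 2 ≤ #A * F - (#A % F : ℕ) * (F - (#A % F : ℕ)) := by
  have key := mod_mul_sub_mod_le_sum univ hF (fiberCard A φ) fun j _ => h j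
  rw [sum_fiberCard] at key
  have hm := (Nat.mod_lt #A hF).le
  have key' : ((#A % F : ℕ) : ℝ) * (F - (#A % F : ℕ)) ≤
      ∑ j, (fiberCard A φ j : ℝ) * (F - fiberCard A φ j) := by
    have := (Nat.cast_le (α := ℝ)).2 key
    push_cast [Nat.cast_sub hm] at this
    simp_rw [Nat.cast_sub (h _)] at this
    exact_mod_cast this
  have hs : (#A : ℝ) = ∑ j, (fiberCard A φ j : ℝ) := by
    rw [← sum_fiberCard A φ]
    push_cast
    rfl
  have : ∑ j, (fiberCard A φ j : ℝ) * (F - fiberCard A φ j) =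
      #A * F - ∑ j, (fiberCard A φ j : ℝ) ^ 2 := by
    rw [hs, Finset.sum_mul, ← Finset.sum_sub_distrib]
    exact Finset.sum_congr rfl fun j _ => by ring
  linarith

end Fibers

section Slices

variable {V : Type} [AddCommGroup V] [Module (ZMod 5) V]

/-- No five distinct elements of `A` sum to zero. -/
def AvoidsDistinctZeroSum (A : Finset V) : Prop :=
  ∀ x : Fin 5 → V, Function.Injective x → (∀ i, x i ∈ A) → ∑ i, x i ≠ 0

/-- Only constant quintuples of elements of `A` sum to zero. -/
def OnlyConstantZeroSum (A : Finset V) : Prop :=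
  ∀ x : Fin 5 → V, (∀ i, x i ∈ A) → ∑ i, x i = 0 → ∀ i j, x i = x j

theorem five_nsmul_eq_zero_s3 (v : V) : 5 • v = 0 := by
  rw [← Nat.cast_smul_eq_nsmul (ZMod 5), show ((5 : ℕ) : ZMod 5) = 0 from rfl, zero_smul]

/-- The hyperplane section of `A` through `a` parallel to `ker φ`, translated into `ker φ`. -/
noncomputable def kerSlice (A : Finset V) (φ : Module.Dual (ZMod 5) V) (a : V) :
    Finset (LinearMap.ker φ) :=
  A.preimage (fun v => (v : V) + a) fun _ _ _ _ h => Subtype.ext (add_right_cancel h)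

theorem mem_kerSlice {A : Finset V} {φ : Module.Dual (ZMod 5) V} {a : V} {v : LinearMap.ker φ} :
    v ∈ kerSlice A φ a ↔ (v : V) + a ∈ A :=
  Finset.mem_preimage

theorem card_kerSlice (A : Finset V) (φ : Module.Dual (ZMod 5) V) (a : V) :
    #(kerSlice A φ a) = fiberCard A φ (φ a) := by
  refine Finset.card_bij (fun v _ => (v : V) + a) ?_ ?_ ?_
  · intro v hv
    simp [mem_kerSlice.1 hv]
  · intro v _ w _ h
    exact Subtype.ext (add_right_cancel h)
  · intro x hx
    obtain ⟨hxA, hxφ⟩ := Finset.mem_filter.1 hx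
    exact ⟨⟨x - a, by simp [hxφ]⟩, mem_kerSlice.2 (by simpa using hxA), by simp⟩

theorem sum_coe_add_eq {W : Submodule (ZMod 5) V} (x : Fin 5 → W) (a : V) :
    ∑ i, ((x i : V) + a) = ((∑ i, x i : W) : V) := by
  simp [Finset.sum_add_distrib, five_nsmul_eq_zero_s3]

theorem AvoidsDistinctZeroSum.kerSlice {A : Finset V} (hA : AvoidsDistinctZeroSum A)
    (φ : Module.Dual (ZMod 5) V) (a : V) : AvoidsDistinctZeroSum (kerSlice A φ a) := by
  intro x hx hxA hs
  refine hA (fun i => (x i : V) + a) (fun i j h => hx (Subtype.ext (add_right_cancel h)))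
    (fun i => mem_kerSlice.1 (hxA i)) ?_
  rw [sum_coe_add_eq, hs, Submodule.coe_zero]

theorem OnlyConstantZeroSum.kerSlice {A : Finset V} (hA : OnlyConstantZeroSum A)
    (φ : Module.Dual (ZMod 5) V) (a : V) : OnlyConstantZeroSum (kerSlice A φ a) := by
  intro x hxA hs i j
  refine Subtype.ext (add_right_cancel (b := a)
    (hA (fun i => (x i : V) + a) (fun i => mem_kerSlice.1 (hxA i)) ?_ i j))
  rw [sum_coe_add_eq, hs, Submodule.coe_zero]

theorem fiberCard_le_of_kerSlice {A : Finset V} {φ : Module.Dual (ZMod 5) V} {F : ℕ}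
    (h : ∀ a, #(kerSlice A φ a) ≤ F) (j : ZMod 5) : fiberCard A φ j ≤ F := by
  rcases Finset.eq_empty_or_nonempty {x ∈ A | φ x = j} with he | ⟨a, ha⟩
  · simp [fiberCard, he]
  · rw [← (Finset.mem_filter.1 ha).2, ← card_kerSlice]
    exact h a

end Slices

section DistinctElements

variable {V : Type} [AddCommGroup V] [Module (ZMod 5) V]

theorem card_zeroSum_eq_le [DecidableEq V] (A : Finset V) {i j : Fin 5} (hij : i ≠ j) :
    ∃ k : Fin 4, #{x ∈ Fintype.piFinset fun _ : Fin 5 => A | ∑ i, x i = 0 ∧ x i = x j} ≤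
      solutionCount A (Function.update (1 : Fin 4 → ZMod 5) k 2) := by
  obtain ⟨k, hk⟩ := Fin.exists_succAbove_eq hij
  refine ⟨k, Finset.card_le_card_of_injOn (fun x l => x (j.succAbove l)) ?_ ?_⟩
  · intro x hx
    simp only [coe_filter, Fintype.mem_piFinset, Set.mem_ofPred_eq] at hx ⊢
    refine ⟨fun l => hx.1 _, ?_⟩
    rw [← hx.2.1, Fin.sum_univ_succAbove x j, ← hx.2.2, ← hk,
      ← Finset.add_sum_erase _ _ (Finset.mem_univ k), Function.update_self,
      ← Finset.add_sum_erase _ (fun l => x (j.succAbove l)) (Finset.mem_univ k), two_smul,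
      add_assoc]
    congr 2
    refine Finset.sum_congr rfl fun l hl => ?_
    simp [Function.update_of_ne (Finset.ne_of_mem_erase hl)]
  · intro x hx y hy hxy
    simp only [coe_filter, Set.mem_ofPred_eq] at hx hy
    have h : ∀ l, x (j.succAbove l) = y (j.succAbove l) := congrFun hxy
    funext m
    rcases eq_or_ne m j with rfl | hm
    · rw [← hx.2.2, ← hy.2.2, ← hk, h]
    · obtain ⟨l, rfl⟩ := Fin.exists_succAbove_eq hm
      exact h l

theorem AvoidsDistinctZeroSum.solutionCount_le [DecidableEq V] {A : Finset V}
    (hA : AvoidsDistinctZeroSum A) :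
    solutionCount A (1 : Fin 5 → ZMod 5) ≤
      ∑ p : Fin 5 × Fin 5 with p.1 < p.2,
        #{x ∈ Fintype.piFinset fun _ : Fin 5 => A | ∑ i, x i = 0 ∧ x p.1 = x p.2} := by
  refine le_trans (Finset.card_le_card ?_) Finset.card_biUnion_le
  intro x hx
  simp only [Pi.one_apply, one_smul, mem_filter, Fintype.mem_piFinset] at hx
  obtain ⟨i, j, hij, hlt⟩ : ∃ i j, x i = x j ∧ i < j := by
    by_contra! hc
    refine hA x (fun i j h => ?_) hx.1 hx.2
    exact le_antisymm (hc j i h.symm) (hc i j h)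
  simp only [mem_biUnion, mem_filter, mem_univ, true_and, Fintype.mem_piFinset, Prod.exists]
  exact ⟨i, j, hlt, hx.1, hx.2, hij⟩

theorem re_five_pow_mul_natCast (n m : ℕ) : ((5 : ℂ) ^ n * m).re = (5 : ℝ) ^ n * m := by
  norm_cast

variable [Finite V]

theorem AvoidsDistinctZeroSum.re_sum_le {A : Finset V} (hA : AvoidsDistinctZeroSum A)
    [Fintype (Module.Dual (ZMod 5) V)] :
    (∑ φ : Module.Dual (ZMod 5) V, (indicatorCoeff A φ ^ 5 -
      10 * (indicatorCoeff A ((2 : ZMod 5) • φ) * indicatorCoeff A φ ^ 3))).re ≤ 0 := by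
  classical
  set n := Module.finrank (ZMod 5) V
  set t := (∑ φ : Module.Dual (ZMod 5) V,
    indicatorCoeff A ((2 : ZMod 5) • φ) * indicatorCoeff A φ ^ 3).re with ht
  have hpair : ∀ p ∈ ({p : Fin 5 × Fin 5 | p.1 < p.2} : Finset (Fin 5 × Fin 5)),
      (5 : ℝ) ^ n *
        #{x ∈ Fintype.piFinset fun _ : Fin 5 => A | ∑ i, x i = 0 ∧ x p.1 = x p.2} ≤ t := by
    intro p hp
    obtain ⟨k, hk⟩ := card_zeroSum_eq_le A (Finset.mem_filter.1 hp).2.ne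
    rw [ht, sum_indicatorCoeff_two_smul_mul_pow A k, re_five_pow_mul_natCast]
    gcongr
  have h5 : (∑ φ : Module.Dual (ZMod 5) V, indicatorCoeff A φ ^ 5).re =
      (5 : ℝ) ^ n * solutionCount A (1 : Fin 5 → ZMod 5) := by
    rw [sum_indicatorCoeff_pow_five, re_five_pow_mul_natCast]
  have hc : #({p : Fin 5 × Fin 5 | p.1 < p.2} : Finset (Fin 5 × Fin 5)) = 10 := by decide
  have hle := Finset.sum_le_card_nsmul _ _ _ hpair
  rw [hc, ← Finset.mul_sum] at hle
  have hsol : (solutionCount A (1 : Fin 5 → ZMod 5) : ℝ) ≤ _ := Nat.cast_le.2 hA.solutionCount_le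
  rw [Nat.cast_sum] at hsol
  have h1 := mul_le_mul_of_nonneg_left hsol (show (0 : ℝ) ≤ 5 ^ n by positivity)
  rw [Finset.sum_sub_distrib, ← Finset.mul_sum, Complex.sub_re, h5]
  have h10 : (10 * ∑ φ : Module.Dual (ZMod 5) V,
      indicatorCoeff A ((2 : ZMod 5) • φ) * indicatorCoeff A φ ^ 3).re = 10 * t := by
    simp [ht]
  rw [h10]
  simp only [nsmul_eq_mul, Nat.cast_ofNat] at hle
  linarith

theorem AvoidsDistinctZeroSum.card_inequality {A : Finset V} (hA : AvoidsDistinctZeroSum A)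
    {R : ℝ} (hR : 0 ≤ R)
    (h : ∀ φ : Module.Dual (ZMod 5) V, φ ≠ 0 →
      ‖indicatorCoeff A φ‖ ^ 2 + ‖indicatorCoeff A ((2 : ZMod 5) • φ)‖ ^ 2 ≤ R ^ 2) :
    (#A : ℝ) ^ 5 - 10 * (#A : ℝ) ^ 4 ≤
      (R ^ 3 + 5 * R ^ 2) * ((5 : ℝ) ^ Module.finrank (ZMod 5) V * #A - (#A : ℝ) ^ 2) := by
  classical
  have := Fintype.ofFinite (Module.Dual (ZMod 5) V)
  have hre := hA.re_sum_le
  have hpars := sum_norm_indicatorCoeff_sq A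
  rw [← Finset.add_sum_erase _ _ (Finset.mem_univ 0)] at hre hpars
  have hterm : ∀ φ ∈ (univ : Finset (Module.Dual (ZMod 5) V)).erase 0,
      -((R ^ 3 + 5 * R ^ 2) * ‖indicatorCoeff A φ‖ ^ 2) ≤ (indicatorCoeff A φ ^ 5 -
        10 * (indicatorCoeff A ((2 : ZMod 5) • φ) * indicatorCoeff A φ ^ 3)).re := by
    intro φ hφ
    have hs := h φ (Finset.ne_of_mem_erase hφ)
    have hn := (abs_le.1 (Complex.abs_re_le_norm (indicatorCoeff A φ ^ 5 -
        10 * (indicatorCoeff A ((2 : ZMod 5) • φ) * indicatorCoeff A φ ^ 3)))).1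
    have htri := norm_sub_le (indicatorCoeff A φ ^ 5)
      (10 * (indicatorCoeff A ((2 : ZMod 5) • φ) * indicatorCoeff A φ ^ 3))
    simp only [norm_mul, norm_pow, Complex.norm_ofNat] at htri
    have ha := norm_nonneg (indicatorCoeff A φ)
    have hb := norm_nonneg (indicatorCoeff A ((2 : ZMod 5) • φ))
    generalize ‖indicatorCoeff A φ‖ = a at *
    generalize ‖indicatorCoeff A ((2 : ZMod 5) • φ)‖ = b at *
    have haR : a ≤ R := abs_le_of_sq_le_sq' (by nlinarith) hR |>.2
    have h5 : a ^ 5 ≤ R ^ 3 * a ^ 2 := by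
      calc a ^ 5 = a ^ 3 * a ^ 2 := by ring
        _ ≤ R ^ 3 * a ^ 2 := by gcongr
    have h3 : b * a ^ 3 ≤ R ^ 2 / 2 * a ^ 2 := by
      calc b * a ^ 3 = (b * a) * a ^ 2 := by ring
        _ ≤ R ^ 2 / 2 * a ^ 2 := by
          gcongr
          nlinarith [sq_nonneg (a - b)]
    linarith
  have hsum := Finset.sum_le_sum hterm
  rw [Finset.sum_neg_distrib, ← Finset.mul_sum] at hsum
  rw [Complex.add_re, Complex.re_sum] at hre
  have hzero : (indicatorCoeff A 0 ^ 5 -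
      10 * (indicatorCoeff A ((2 : ZMod 5) • 0) * indicatorCoeff A 0 ^ 3)).re =
      (#A : ℝ) ^ 5 - 10 * (#A : ℝ) ^ 4 := by
    rw [smul_zero, indicatorCoeff_zero]
    have : ((#A : ℂ) ^ 5 - 10 * (#A * (#A : ℂ) ^ 3)) =
        (((#A : ℝ) ^ 5 - 10 * (#A : ℝ) ^ 4 : ℝ) : ℂ) := by
      push_cast
      ring
    rw [this, Complex.ofReal_re]
  rw [hzero] at hre
  rw [indicatorCoeff_zero, Complex.norm_natCast] at hpars
  rw [← hpars, add_sub_cancel_left]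
  linarith

end DistinctElements

/-- Every set without five distinct elements of sum zero in an `n`-dimensional space has at most
`B` elements. -/
def DistinctBound (n B : ℕ) : Prop :=
  ∀ (V : Type) [AddCommGroup V] [Module (ZMod 5) V] [Finite V],
    Module.finrank (ZMod 5) V = n → ∀ A : Finset V, AvoidsDistinctZeroSum A → #A ≤ B

/-- Every set with only constant zero-sum quintuples in an `n`-dimensional space has at most
`B` elements. -/
def ConstantBound (n B : ℕ) : Prop :=
  ∀ (V : Type) [AddCommGroup V] [Module (ZMod 5) V] [Finite V],
    Module.finrank (ZMod 5) V = n → ∀ A : Finset V, OnlyConstantZeroSum A → #A ≤ B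

theorem distinctBound_one : DistinctBound 1 4 := by
  intro V _ _ _ hV A hA
  have := Fintype.ofFinite V
  have hcard : Fintype.card V = 5 := by
    rw [Module.card_eq_pow_finrank (K := ZMod 5), hV]
    simp
  by_contra! hlt
  have hAu : A = univ := Finset.eq_univ_of_card A (le_antisymm (card_le_univ A) (by omega))
  let e : Fin 5 ≃ V := (Fintype.equivFinOfCardEq hcard).symm
  refine hA e e.injective (by simp [hAu]) ?_
  rw [e.sum_comp fun v => v]
  have h2 : (2 : ZMod 5) • ∑ v : V, v = ∑ v : V, v := by
    rw [Finset.smul_sum]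
    exact (LinearEquiv.smulOfNeZero (ZMod 5) V 2 (by decide)).toEquiv.sum_comp fun v => v
  rwa [two_smul, add_eq_left] at h2

theorem DistinctBound.succ {n F B : ℕ} (h : DistinctBound n F) (hF : 0 < F) {R : ℝ} (hR : 0 ≤ R)
    (hRF : 5 * (((B + 1 : ℕ) : ℝ) * F - ((B + 1) % F : ℕ) * (F - ((B + 1) % F : ℕ))) -
      ((B + 1 : ℕ) : ℝ) ^ 2 ≤ 2 * R ^ 2)
    (hB : (R ^ 3 + 5 * R ^ 2) * ((5 : ℝ) ^ (n + 1) * (B + 1 : ℕ) - ((B + 1 : ℕ) : ℝ) ^ 2) <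
      ((B + 1 : ℕ) : ℝ) ^ 5 - 10 * ((B + 1 : ℕ) : ℝ) ^ 4) :
    DistinctBound (n + 1) B := by
  intro V _ _ _ hV A hA
  by_contra! hlt
  obtain ⟨A', hAA', hcard⟩ := Finset.exists_subset_card_eq (show B + 1 ≤ #A from hlt)
  have hA' : AvoidsDistinctZeroSum A' := fun x hx hxA => hA x hx fun i => hAA' (hxA i)
  refine absurd (hA'.card_inequality hR fun φ hφ => ?_) (not_le.2 ?_)
  · have hker := Module.Dual.finrank_ker_add_one_of_ne_zero hφ
    have hfib := sum_fiberCard_sq_le A' φ hF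
      (fiberCard_le_of_kerSlice fun a => h _ (by omega) _ (hA'.kerSlice φ a))
    have heq := norm_indicatorCoeff_sq_add A' φ
    rw [hcard] at hfib heq
    linarith
  · rw [hcard, hV]
    exact hB

theorem distinctBound_five : DistinctBound 5 329 := by
  have h2 : DistinctBound 2 12 := by
    refine distinctBound_one.succ (R := 6.2) ?_ ?_ ?_ ?_ <;> norm_num
  have h3 : DistinctBound 3 33 := by
    refine h2.succ (R := 19.85) ?_ ?_ ?_ ?_ <;> norm_num
  have h4 : DistinctBound 4 101 := by
    refine h3.succ (R := 54.8) ?_ ?_ ?_ ?_ <;> norm_num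
  refine h4.succ (R := 155) ?_ ?_ ?_ ?_ <;> norm_num

section ConstantQuintuples

variable {V : Type} [AddCommGroup V] [Module (ZMod 5) V]

theorem re_stdAddChar_one : (ZMod.stdAddChar (1 : ZMod 5) : ℂ).re = (√5 - 1) / 4 := by
  have h : (ZMod.stdAddChar (1 : ZMod 5) : ℂ) =
      Complex.exp (((2 * (Real.pi / 5) : ℝ) : ℂ) * Complex.I) := by
    have := ZMod.stdAddChar_coe (N := 5) 1
    rw [Int.cast_one] at this
    rw [this]
    congr 1
    push_cast
    ring
  rw [h, Complex.exp_ofReal_mul_I_re, Real.cos_two_mul, Real.cos_pi_div_five]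
  have h5 : √5 ^ 2 = (5 : ℝ) := Real.sq_sqrt (by norm_num)
  linear_combination h5 / 8

theorem re_stdAddChar_two : (ZMod.stdAddChar (2 : ZMod 5) : ℂ).re = -(√5 + 1) / 4 := by
  have h : (ZMod.stdAddChar (2 : ZMod 5) : ℂ) =
      ZMod.stdAddChar (1 : ZMod 5) * ZMod.stdAddChar (1 : ZMod 5) := by
    rw [← AddChar.map_add_eq_mul]
    rfl
  have hn : (ZMod.stdAddChar (1 : ZMod 5) : ℂ).re ^ 2 + (ZMod.stdAddChar (1 : ZMod 5) : ℂ).im ^ 2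
      = 1 := by
    rw [← Complex.normSq_add_mul_I, Complex.re_add_im, Complex.normSq_eq_norm_sq,
      AddChar.norm_apply, one_pow]
  have h5 : √5 ^ 2 = (5 : ℝ) := Real.sq_sqrt (by norm_num)
  rw [h, Complex.mul_re]
  rw [re_stdAddChar_one] at hn ⊢
  linear_combination h5 / 8 - hn

/-- A bound for the real part of `z ^ 5` when multiplying `z` by the unit complex number `w` or its
conjugate does not increase its real part. -/
theorem re_pow_five_le {z w : ℂ} (hw : ‖w‖ = 1) (hwre : 0 ≤ w.re) (hwre' : w.re < 1) {h : ℝ}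
    (hz : z.re ≤ h) (h1 : (w * z).re ≤ z.re) (h2 : ((starRingEnd ℂ) w * z).re ≤ z.re) :
    (z ^ 5).re ≤ h ^ 3 * ‖z‖ ^ 2 := by
  have hn : w.re ^ 2 + w.im ^ 2 = 1 := by
    rw [← Complex.normSq_add_mul_I, Complex.re_add_im, Complex.normSq_eq_norm_sq, hw, one_pow]
  have hre : (z ^ 5).re = z.re ^ 5 - 10 * z.re ^ 3 * z.im ^ 2 + 5 * z.re * z.im ^ 4 := by
    simp only [pow_succ, pow_zero, one_mul, Complex.mul_re, Complex.mul_im]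
    ring
  rw [hre, ← Complex.normSq_eq_norm_sq, Complex.normSq_apply]
  simp only [Complex.mul_re, Complex.conj_re, Complex.conj_im] at h1 h2
  generalize z.re = x at *
  generalize z.im = y at *
  generalize w.re = c at *
  generalize w.im = s at *
  have hx : 0 ≤ x := by nlinarith
  have hy : y ^ 2 ≤ x ^ 2 := by
    have hsq : (s * y) ^ 2 ≤ ((1 - c) * x) ^ 2 := sq_le_sq' (by linarith) (by linarith)
    have hc : (1 - c) * ((1 + c) * y ^ 2) ≤ (1 - c) * ((1 - c) * x ^ 2) := by
      have : s ^ 2 = (1 - c) * (1 + c) := by linarith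
      nlinarith
    have hc' := le_of_mul_le_mul_left hc (by linarith)
    nlinarith [sq_nonneg x, sq_nonneg y]
  have hcube : x ^ 3 ≤ h ^ 3 := by gcongr
  have h4 : x * y ^ 2 * y ^ 2 ≤ x * y ^ 2 * x ^ 2 := by gcongr
  have h6 : x ^ 3 * (x * x + y * y) ≤ h ^ 3 * (x * x + y * y) :=
    mul_le_mul_of_nonneg_right hcube (by nlinarith)
  have h7 : 0 ≤ x ^ 3 * y ^ 2 := by positivity
  linarith

theorem neg_re_rotate_le (A : Finset V) (φ : Module.Dual (ZMod 5) V) {F : ℕ}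
    (hF : ∀ j, fiberCard A φ j ≤ F) (d : ZMod 5) :
    (-(ZMod.stdAddChar d * indicatorCoeff A φ)).re ≤ √5 * F - (√5 - 1) / 4 * #A := by
  have h3 : (ZMod.stdAddChar (3 : ZMod 5) : ℂ).re = -(√5 + 1) / 4 := by
    rw [← re_stdAddChar_two, show (3 : ZMod 5) = -2 from rfl, AddChar.map_neg_eq_conj,
      Complex.conj_re]
  have h4 : (ZMod.stdAddChar (4 : ZMod 5) : ℂ).re = (√5 - 1) / 4 := by
    rw [← re_stdAddChar_one, show (4 : ZMod 5) = -1 from rfl, AddChar.map_neg_eq_conj,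
      Complex.conj_re]
  have hu : ∀ g : ZMod 5 → ℝ, ∑ k, g k = g 0 + g 1 + g 2 + g 3 + g 4 := fun g =>
    Fin.sum_univ_five g
  have hsum : (#A : ℝ) = ∑ j, (fiberCard A φ (j - d) : ℝ) := by
    rw [← sum_fiberCard A φ, Nat.cast_sum]
    exact ((Equiv.subRight d).sum_comp fun j => (fiberCard A φ j : ℝ)).symm
  have hre : (ZMod.stdAddChar d * indicatorCoeff A φ).re =
      ∑ j, (fiberCard A φ (j - d) : ℝ) * (ZMod.stdAddChar j : ℂ).re := by
    rw [indicatorCoeff_eq_sum_fiberCard, ← (Equiv.subRight d).sum_comp, Finset.mul_sum,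
      Complex.re_sum]
    refine Finset.sum_congr rfl fun j _ => ?_
    rw [← Complex.re_ofReal_mul, mul_left_comm, ← AddChar.map_add_eq_mul]
    simp
  have hs5 : 1 ≤ √5 := Real.one_le_sqrt.2 (by norm_num)
  have hs5' : √5 ≤ 5 := Real.sqrt_le_iff.2 (by norm_num)
  rw [Complex.neg_re, hre, hsum, hu, hu, re_stdAddChar_one, re_stdAddChar_two, h3, h4,
    AddChar.map_zero_eq_one, Complex.one_re]
  have hb2 : (fiberCard A φ (2 - d) : ℝ) ≤ F := by exact_mod_cast hF _
  have hb3 : (fiberCard A φ (3 - d) : ℝ) ≤ F := by exact_mod_cast hF _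
  have hb0 : (0 : ℝ) ≤ fiberCard A φ (0 - d) := by positivity
  nlinarith

theorem neg_re_indicatorCoeff_pow_five_le (A : Finset V) (φ : Module.Dual (ZMod 5) V) {F : ℕ}
    (hF : ∀ j, fiberCard A φ j ≤ F) :
    -(indicatorCoeff A φ ^ 5).re ≤
      (√5 * F - (√5 - 1) / 4 * #A) ^ 3 * ‖indicatorCoeff A φ‖ ^ 2 := by
  obtain ⟨d, hd⟩ := Finite.exists_max
    fun d : ZMod 5 => (-(ZMod.stdAddChar d * indicatorCoeff A φ)).re
  have hs5 : √5 < 3 := (Real.sqrt_lt' (by norm_num)).2 (by norm_num)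
  have hs5' : 1 ≤ √5 := Real.one_le_sqrt.2 (by norm_num)
  have hpow : (ZMod.stdAddChar d : ℂ) ^ 5 = 1 := by
    rw [← AddChar.map_nsmul_eq_pow, five_nsmul_eq_zero_s3, AddChar.map_zero_eq_one]
  have h := re_pow_five_le (z := -(ZMod.stdAddChar d * indicatorCoeff A φ))
    (w := ZMod.stdAddChar (1 : ZMod 5)) (AddChar.norm_apply _ _)
    (by rw [re_stdAddChar_one]; linarith) (by rw [re_stdAddChar_one]; linarith)
    (neg_re_rotate_le A φ hF d)
    (by
      rw [mul_neg, ← mul_assoc, ← AddChar.map_add_eq_mul]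
      exact hd _)
    (by
      rw [← AddChar.map_neg_eq_conj, mul_neg, ← mul_assoc, ← AddChar.map_add_eq_mul]
      exact hd _)
  rwa [norm_neg, norm_mul, AddChar.norm_apply, one_mul, Odd.neg_pow (by decide), mul_pow, hpow,
    one_mul, Complex.neg_re] at h

theorem OnlyConstantZeroSum.solutionCount_le [DecidableEq V] {A : Finset V}
    (hA : OnlyConstantZeroSum A) : solutionCount A (1 : Fin 5 → ZMod 5) ≤ #A := by
  refine Finset.card_le_card_of_injOn (fun x => x 0) ?_ ?_
  · intro x hx
    simp only [coe_filter, Fintype.mem_piFinset, Set.mem_ofPred_eq] at hx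
    exact hx.1 0
  · intro x hx y hy hxy
    simp only [Pi.one_apply, one_smul, coe_filter, Fintype.mem_piFinset, Set.mem_ofPred_eq] at hx hy
    funext i
    rw [hA x hx.1 hx.2 i 0, hA y hy.1 hy.2 i 0]
    exact hxy

theorem OnlyConstantZeroSum.card_inequality [Finite V] {A : Finset V}
    (hA : OnlyConstantZeroSum A) {H : ℝ}
    (h : ∀ φ : Module.Dual (ZMod 5) V, φ ≠ 0 →
      -(indicatorCoeff A φ ^ 5).re ≤ H * ‖indicatorCoeff A φ‖ ^ 2) :
    (#A : ℝ) ^ 5 - (5 : ℝ) ^ Module.finrank (ZMod 5) V * #A ≤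
      H * ((5 : ℝ) ^ Module.finrank (ZMod 5) V * #A - (#A : ℝ) ^ 2) := by
  classical
  have := Fintype.ofFinite (Module.Dual (ZMod 5) V)
  have hre := congrArg Complex.re (sum_indicatorCoeff_pow_five A)
  have hpars := sum_norm_indicatorCoeff_sq A
  rw [← Finset.add_sum_erase _ _ (Finset.mem_univ 0)] at hre hpars
  have hsum := Finset.sum_le_sum
    fun φ (hφ : φ ∈ (univ : Finset (Module.Dual (ZMod 5) V)).erase 0) =>
      h φ (Finset.ne_of_mem_erase hφ)
  rw [Finset.sum_neg_distrib, ← Finset.mul_sum] at hsum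
  have hzero : (indicatorCoeff A 0 ^ 5).re = (#A : ℝ) ^ 5 := by
    rw [indicatorCoeff_zero]
    norm_cast
  rw [re_five_pow_mul_natCast, Complex.add_re, Complex.re_sum, hzero] at hre
  rw [indicatorCoeff_zero, Complex.norm_natCast] at hpars
  have hle : (solutionCount A (1 : Fin 5 → ZMod 5) : ℝ) ≤ #A := by
    exact_mod_cast hA.solutionCount_le
  have hle' := mul_le_mul_of_nonneg_left hle
    (show (0 : ℝ) ≤ 5 ^ Module.finrank (ZMod 5) V by positivity)
  have hH : H * ((5 : ℝ) ^ Module.finrank (ZMod 5) V * #A - (#A : ℝ) ^ 2) =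
      H * ∑ φ ∈ (univ : Finset (Module.Dual (ZMod 5) V)).erase 0, ‖indicatorCoeff A φ‖ ^ 2 := by
    rw [← hpars, add_sub_cancel_left]
  rw [hH]
  linarith

end ConstantQuintuples

theorem constantBound_zero : ConstantBound 0 1 := by
  intro V _ _ _ hV A _
  have := Module.finrank_zero_iff.1 hV
  exact Finset.card_le_one_of_subsingleton A

theorem ConstantBound.succ {n F B : ℕ} (h : ConstantBound n F) {H : ℝ}
    (hH : √5 * F - (√5 - 1) / 4 * (B + 1 : ℕ) ≤ H)
    (hB : H ^ 3 * ((5 : ℝ) ^ (n + 1) * (B + 1 : ℕ) - ((B + 1 : ℕ) : ℝ) ^ 2) <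
      ((B + 1 : ℕ) : ℝ) ^ 5 - (5 : ℝ) ^ (n + 1) * (B + 1 : ℕ)) :
    ConstantBound (n + 1) B := by
  intro V _ _ _ hV A hA
  by_contra! hlt
  obtain ⟨A', hAA', hcard⟩ := Finset.exists_subset_card_eq (show B + 1 ≤ #A from hlt)
  have hA' : OnlyConstantZeroSum A' := fun x hxA => hA x fun i => hAA' (hxA i)
  refine absurd (hA'.card_inequality (H := H ^ 3) fun φ hφ => ?_) (not_le.2 ?_)
  · have hker := Module.Dual.finrank_ker_add_one_of_ne_zero hφ
    refine (neg_re_indicatorCoeff_pow_five_le A' φ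
      (fiberCard_le_of_kerSlice fun a => h _ (by omega) _ (hA'.kerSlice φ a))).trans ?_
    rw [hcard]
    refine mul_le_mul_of_nonneg_right ?_ (sq_nonneg _)
    exact (Odd.strictMono_pow (show Odd 3 by decide)).monotone hH
  · rw [hcard, hV]
    exact hB

theorem constantBound_five : ConstantBound 5 120 := by
  have hl : (2.236 : ℝ) ≤ √5 := Real.le_sqrt_of_sq_le (by norm_num)
  have hu : √5 ≤ (2.2361 : ℝ) := Real.sqrt_le_iff.2 (by norm_num)
  have h1 : ConstantBound 1 2 := by
    refine constantBound_zero.succ (H := 1.4) ?_ (by norm_num)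
    norm_num
    linarith
  have h2 : ConstantBound 2 4 := by
    refine h1.succ (H := 3) ?_ (by norm_num)
    norm_num
    linarith
  have h3 : ConstantBound 3 11 := by
    refine h2.succ (H := 5.3) ?_ (by norm_num)
    norm_num
    linarith
  have h4 : ConstantBound 4 35 := by
    refine h3.succ (H := 13.6) ?_ (by norm_num)
    norm_num
    linarith
  refine h4.succ (H := 40.9) ?_ (by norm_num)
  norm_num
  linarith

theorem avoidsDistinctZeroSum_toFinset {V : Type} [AddCommGroup V] [DecidableEq V] {S : Multiset V}
    (hS : ∀ T ≤ S, T.card = 5 → T.sum ≠ 0) : AvoidsDistinctZeroSum S.toFinset := by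
  intro x hx hxS
  refine hS (univ.val.map x) ((Multiset.le_iff_subset (univ.nodup.map hx)).2 fun v hv => ?_)
    (by simp)
  obtain ⟨i, -, rfl⟩ := Multiset.mem_map.1 hv
  exact Multiset.mem_toFinset.1 (hxS i)

theorem onlyConstantZeroSum_two_le_count {V : Type} [AddCommGroup V] [Module (ZMod 5) V]
    [DecidableEq V] {S : Multiset V}
    (hS : ∀ T ≤ S, T.card = 5 → T.sum ≠ 0) :
    OnlyConstantZeroSum {v ∈ S.toFinset | 2 ≤ S.count v} := by
  have hle : ∀ T : Multiset V, (∀ v ∈ T, 2 ≤ S.count v) → (∀ v, T.count v ≤ 2) → T ≤ S := by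
    refine fun T hT h2 => Multiset.le_iff_count.2 fun v => ?_
    by_cases hv : v ∈ T
    · exact (h2 v).trans (hT v hv)
    · simp [Multiset.count_eq_zero_of_notMem hv]
  intro x hxA hsum
  have hxS : ∀ v ∈ univ.val.map x, 2 ≤ S.count v := by
    intro v hv
    obtain ⟨i, -, rfl⟩ := Multiset.mem_map.1 hv
    exact (mem_filter.1 (hxA i)).2
  have hmem : ∀ i, x i ∈ univ.val.map x := fun i => Multiset.mem_map_of_mem x (mem_univ_val i)
  have hcard : (univ.val.map x).card = 5 := by simp
  replace hsum : (univ.val.map x).sum = 0 := hsum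
  generalize univ.val.map x = T at *
  have hnot : ¬ ∀ v, T.count v ≤ 2 := fun h => hS T (hle T hxS h) hcard hsum
  push Not at hnot
  obtain ⟨v, hv⟩ := hnot
  obtain ⟨U, rfl⟩ := Multiset.le_iff_exists_add.1 (Multiset.le_count_iff_replicate_le.1 hv)
  obtain ⟨y, z, rfl⟩ : ∃ y z, U = {y, z} := by
    refine Multiset.card_eq_two.1 ?_
    simp only [Multiset.card_add, Multiset.card_replicate] at hcard
    omega
  have hv5 := five_nsmul_eq_zero_s3 v
  have hyz : y + z = v + v := by
    simp only [Multiset.sum_add, Multiset.sum_replicate, Multiset.insert_eq_cons,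
      Multiset.sum_cons, Multiset.sum_singleton] at hsum
    have : y + z - (v + v) = (3 • v + (y + z)) - 5 • v := by abel
    rw [hsum, hv5, sub_zero] at this
    exact sub_eq_zero.1 this
  suffices h : y = v ∧ z = v by
    have hxv : ∀ i, x i = v := by simpa [h.1, h.2] using hmem
    exact fun i j => (hxv i).trans (hxv j).symm
  by_cases hy : y = v
  · exact ⟨hy, by rw [hy] at hyz; exact add_left_cancel hyz⟩
  by_cases hz : z = v
  · exact ⟨by rw [hz] at hyz; exact add_right_cancel hyz, hz⟩
  by_cases hyz' : y = z
  · rw [← hyz'] at hyz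
    have : y - v = 3 • (y + y - (v + v)) - 5 • (y - v) := by abel
    rw [hyz, five_nsmul_eq_zero_s3, sub_self, smul_zero, sub_zero] at this
    exact absurd (sub_eq_zero.1 this) hy
  refine absurd ?_ (hS {v, y, y, z, z} (hle _ (fun w hw => hxS w ?_) fun w => ?_) rfl)
  · have : v + (y + (y + (z + z))) = v + (y + z) + (y + z) := by abel
    simp only [Multiset.insert_eq_cons, Multiset.sum_cons, Multiset.sum_singleton]
    rw [this, hyz, ← hv5]
    abel
  · simp only [Multiset.insert_eq_cons, Multiset.mem_cons, Multiset.mem_singleton] at hw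
    simp only [Multiset.insert_eq_cons, Multiset.mem_add, Multiset.mem_replicate,
      Multiset.mem_cons, Multiset.mem_singleton]
    tauto
  · simp only [Multiset.insert_eq_cons, Multiset.count_cons, Multiset.count_singleton]
    grind

theorem card_le_card_toFinset_add {V : Type} [DecidableEq V] {S : Multiset V}
    (hS : ∀ v, S.count v ≤ 4) :
    S.card ≤ #S.toFinset + 3 * #{v ∈ S.toFinset | 2 ≤ S.count v} := by
  rw [← Multiset.toFinset_sum_count_eq, card_eq_sum_ones, card_filter, mul_sum,
    ← sum_add_distrib]
  refine sum_le_sum fun v _ => ?_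
  have := hS v
  split_ifs <;> omega

end PrimeFive

theorem s_const_zmod5_pow5_le :
    ∀ S : Multiset (Fin 5 → ZMod 5), S.card = 690 →
      ∃ T : Multiset (Fin 5 → ZMod 5), T ≤ S ∧ T.card = 5 ∧ T.sum = 0 := by
  intro S hS
  by_contra! hno
  have hcount : ∀ v, S.count v ≤ 4 := by
    intro v
    by_contra! hv
    refine hno (Multiset.replicate 5 v) (Multiset.le_count_iff_replicate_le.1 hv)
      (Multiset.card_replicate 5 v) ?_
    rw [Multiset.sum_replicate, five_nsmul_eq_zero_s3]
  have := fact_prime_five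
  have hfin : Module.finrank (ZMod 5) (Fin 5 → ZMod 5) = 5 := Module.finrank_fin_fun _
  have hdistinct := distinctBound_five _ hfin _ (avoidsDistinctZeroSum_toFinset hno)
  have hconstant := constantBound_five _ hfin _ (onlyConstantZeroSum_two_le_count hno)
  have := card_le_card_toFinset_add hcount
  omega
end
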